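/- arXiv:2105.00692 — 3 statements merged into one kernel-verified Lean document; each statement's English description precedes it below -/
import Mathlib

section
/- Let R be a Cohen-Macaulay commutative Noetherian ring, p a prime ideal, and M a finitely generated R-module with M_p ≠ 0. Set t = depth R_p − depth M_p (a non-negative integer). Then there exists s ∈ R \ p such that s·H^i_a(M) = 0 for all ideals a of R and all integers i < grade(a,R) − t. -/
/-- The supremum of lengths of weakly regular `M`-sequences contained in `I`
(depth of `M` along `I`; `∞` for the zero module). -/
noncomputable def seqDepth {R : Type} [CommRing R] (I : Ideal R)
    (M : Type) [AddCommGroup M] [Module R M] : ℕ∞ :=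
  sSup {n : ℕ∞ | ∃ rs : List R, (∀ r ∈ rs, r ∈ I) ∧
    RingTheory.Sequence.IsWeaklyRegular M rs ∧ rs.length = n}

/-- `grade(I, R)`: the maximal length of an `R`-regular sequence contained in `I`. -/
noncomputable def Ideal.grade {R : Type} [CommRing R] (I : Ideal R) : ℕ∞ := seqDepth I R

/-- depth of the local ring `R_p`. -/
noncomputable def ringDepthAt (R : Type) [CommRing R] (p : Ideal R) [p.IsPrime] : ℕ∞ :=
  seqDepth (IsLocalRing.maximalIdeal (Localization.AtPrime p)) (Localization.AtPrime p)

/-- depth of the localized module `M_p` over the local ring `R_p`. -/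
noncomputable def moduleDepthAt {R : Type} [CommRing R] (p : Ideal R) [p.IsPrime]
    (M : Type) [AddCommGroup M] [Module R M] : ℕ∞ :=
  seqDepth (IsLocalRing.maximalIdeal (Localization.AtPrime p)) (LocalizedModule p.primeCompl M)

/-- `R` is Cohen–Macaulay: every localization at a prime is a Cohen–Macaulay local ring. -/
def IsCohenMacaulayRing (R : Type) [CommRing R] : Prop :=
  ∀ (p : Ideal R) (hp : p.IsPrime),
    haveI := hp
    (ringDepthAt R p : WithBot ℕ∞) = ringKrullDim (Localization.AtPrime p)


open CategoryTheory CategoryTheory.Abelian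

set_option linter.unusedSectionVars false
namespace S13

abbrev EX (R : Type) [CommRing R] (G M : Type) [AddCommGroup G] [Module R G]
    [AddCommGroup M] [Module R M] (j : ℕ) : Type :=
  Ext (ModuleCat.of R G) (ModuleCat.of R M) j

section
variable {R : Type} [CommRing R]
variable {G : Type} [AddCommGroup G] [Module R G]
variable {A B C : Type} [AddCommGroup A] [Module R A] [AddCommGroup B] [Module R B]
  [AddCommGroup C] [Module R C]

noncomputable def fmap (G : Type) [AddCommGroup G] [Module R G] (j : ℕ) (f : A →ₗ[R] B) :
    EX R G A j →ₗ[R] EX R G B j :=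
  Ext.postcompOfLinear (Ext.mk₀ (ModuleCat.ofHom f)) R _ (add_zero j)

noncomputable def gmap (M : Type) [AddCommGroup M] [Module R M] (j : ℕ) (f : A →ₗ[R] B) :
    EX R B M j →ₗ[R] EX R A M j :=
  Ext.precompOfLinear (Ext.mk₀ (ModuleCat.ofHom f)) R _ (zero_add j)

theorem fmap_apply (j : ℕ) (f : A →ₗ[R] B) (e : EX R G A j) :
    fmap G j f e = e.comp (Ext.mk₀ (ModuleCat.ofHom f)) (add_zero j) := rfl

theorem gmap_apply (j : ℕ) (f : A →ₗ[R] B) (e : EX R B C j) :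
    gmap C j f e = (Ext.mk₀ (ModuleCat.ofHom f)).comp e (zero_add j) := rfl

theorem fmap_comp (j : ℕ) (f : A →ₗ[R] B) (g : B →ₗ[R] C) (e : EX R G A j) :
    fmap G j (g.comp f) e = fmap G j g (fmap G j f e) := by
  simp only [fmap_apply, ModuleCat.ofHom_comp, ← Ext.mk₀_comp_mk₀]
  rw [Ext.comp_assoc_of_third_deg_zero]

theorem gmap_comp {M : Type} [AddCommGroup M] [Module R M]
    (j : ℕ) (f : A →ₗ[R] B) (g : B →ₗ[R] C) (e : EX R C M j) :
    gmap M j (g.comp f) e = gmap M j f (gmap M j g e) := by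
  simp only [gmap_apply, ModuleCat.ofHom_comp, ← Ext.mk₀_comp_mk₀]
  rw [Ext.comp_assoc]
  all_goals simp

theorem fmap_smul_id (j : ℕ) (r : R) (e : EX R G A j) :
    fmap G j (r • (LinearMap.id : A →ₗ[R] A)) e = r • e := by
  rw [fmap_apply, Ext.smul_eq_comp_mk₀]; rfl

theorem gmap_smul_id {M : Type} [AddCommGroup M] [Module R M] (j : ℕ) (r : R) (e : EX R A M j) :
    gmap M j (r • (LinearMap.id : A →ₗ[R] A)) e = r • e := by
  have : ModuleCat.ofHom (r • (LinearMap.id : A →ₗ[R] A)) = r • 𝟙 (ModuleCat.of R A) := rfl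
  rw [gmap_apply, this, Ext.mk₀_smul, Ext.smul_comp, Ext.mk₀_id_comp]

theorem fmap_id (j : ℕ) (e : EX R G A j) :
    fmap G j (LinearMap.id : A →ₗ[R] A) e = e := by
  have := fmap_smul_id j (1:R) e
  rwa [one_smul, one_smul] at this

theorem gmap_id {M : Type} [AddCommGroup M] [Module R M] (j : ℕ) (e : EX R A M j) :
    gmap M j (LinearMap.id : A →ₗ[R] A) e = e := by
  have := gmap_smul_id j (1:R) e
  rwa [one_smul, one_smul] at this

theorem ses {f : A →ₗ[R] B} {g : B →ₗ[R] C} (hf : Function.Injective f)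
    (hfg : Function.Exact f g) (hg : Function.Surjective g) :
    ∃ w, (ShortComplex.mk (ModuleCat.ofHom f) (ModuleCat.ofHom g) w).ShortExact := by
  have w : ModuleCat.ofHom f ≫ ModuleCat.ofHom g = 0 := by
    ext x; exact hfg.apply_apply_eq_zero x
  refine ⟨w, ?_⟩
  have h1 : Mono (ModuleCat.ofHom f) := (ModuleCat.mono_iff_injective _).2 hf
  have h2 : Epi (ModuleCat.ofHom g) := (ModuleCat.epi_iff_surjective _).2 hg
  refine { exact := ?_, mono_f := h1, epi_g := h2 }
  rw [ShortComplex.moduleCat_exact_iff]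
  intro x hx
  exact (hfg x).1 hx

theorem les (G : Type) [AddCommGroup G] [Module R G]
    {f : A →ₗ[R] B} {g : B →ₗ[R] C} (hf : Function.Injective f)
    (hfg : Function.Exact f g) (hg : Function.Surjective g) :
    (∀ j, Function.Exact (fmap G j f) (fmap G j g)) ∧
    (∀ j, ∃ d : EX R G C j →ₗ[R] EX R G A (j+1),
      Function.Exact (fmap G j g) d ∧ Function.Exact d (fmap G (j+1) f)) := by
  obtain ⟨w, hS⟩ := ses hf hfg hg
  have hz : ∀ j (e : EX R G A j), fmap G j g (fmap G j f e) = 0 := by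
    intro j e
    rw [← fmap_comp, hfg.linearMap_comp_eq_zero]
    have := fmap_smul_id (A := C) j (0:R) (fmap G j (0 : A →ₗ[R] C) e)
    rw [zero_smul, zero_smul, ← fmap_comp] at this
    simpa using this
  refine ⟨fun j x => ⟨fun hx => ?_, ?_⟩, fun j => ⟨Ext.postcompOfLinear hS.extClass R _ rfl,
      fun x => ⟨fun hx => ?_, ?_⟩, fun x => ⟨fun hx => ?_, ?_⟩⟩⟩
  · exact Ext.covariant_sequence_exact₂ _ hS x hx
  · rintro ⟨e, rfl⟩; exact hz j e
  · exact Ext.covariant_sequence_exact₃ _ hS x rfl hx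
  · rintro ⟨e, rfl⟩
    change (e.comp (Ext.mk₀ (ModuleCat.ofHom g)) (add_zero j)).comp hS.extClass rfl = 0
    rw [Ext.comp_assoc_of_second_deg_zero]
    have := hS.comp_extClass
    dsimp only at this
    rw [this, Ext.comp_zero]
  · exact Ext.covariant_sequence_exact₁ _ hS x hx rfl
  · rintro ⟨e, rfl⟩
    change (e.comp hS.extClass rfl).comp (Ext.mk₀ (ModuleCat.ofHom f)) (add_zero _) = 0
    rw [Ext.comp_assoc_of_third_deg_zero]
    have := hS.extClass_comp
    dsimp only at this
    rw [this, Ext.comp_zero]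

theorem fmap_inj0 (G : Type) [AddCommGroup G] [Module R G]
    {f : A →ₗ[R] B} (hf : Function.Injective f) : Function.Injective (fmap G 0 f) := by
  have h1 : Mono (ModuleCat.ofHom f) := (ModuleCat.mono_iff_injective _).2 hf
  exact Ext.postcomp_mk₀_injective_of_mono _ (ModuleCat.ofHom f)

theorem gmap_inj0 (M : Type) [AddCommGroup M] [Module R M]
    {f : A →ₗ[R] B} (hf : Function.Surjective f) : Function.Injective (gmap M 0 f) := by
  have h1 : Epi (ModuleCat.ofHom f) := (ModuleCat.epi_iff_surjective _).2 hf
  exact Ext.precomp_mk₀_injective_of_epi _ (ModuleCat.ofHom f)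

theorem les' (M : Type) [AddCommGroup M] [Module R M]
    {f : A →ₗ[R] B} {g : B →ₗ[R] C} (hf : Function.Injective f)
    (hfg : Function.Exact f g) (hg : Function.Surjective g) :
    (∀ j, Function.Exact (gmap M j g) (gmap M j f)) ∧
    (∀ j, ∃ d : EX R A M j →ₗ[R] EX R C M (j+1),
      Function.Exact (gmap M j f) d ∧ Function.Exact d (gmap M (j+1) g)) := by
  obtain ⟨w, hS⟩ := ses hf hfg hg
  have hz : ∀ j (e : EX R C M j), gmap M j f (gmap M j g e) = 0 := by
    intro j e
    rw [← gmap_comp, hfg.linearMap_comp_eq_zero]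
    have := gmap_smul_id (A := A) j (0:R) (gmap M j (0 : A →ₗ[R] C) e)
    rw [zero_smul, zero_smul, ← gmap_comp] at this
    simpa using this
  refine ⟨fun j x => ⟨fun hx => ?_, ?_⟩, fun j => ⟨Ext.precompOfLinear hS.extClass R _ (add_comm 1 j),
      fun x => ⟨fun hx => ?_, ?_⟩, fun x => ⟨fun hx => ?_, ?_⟩⟩⟩
  · exact Ext.contravariant_sequence_exact₂ hS _ x hx
  · rintro ⟨e, rfl⟩; exact hz j e
  · exact Ext.contravariant_sequence_exact₁ hS _ x (add_comm 1 j) hx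
  · rintro ⟨e, rfl⟩
    change hS.extClass.comp ((Ext.mk₀ (ModuleCat.ofHom f)).comp e (zero_add j)) (add_comm 1 j) = 0
    rw [← Ext.comp_assoc_of_second_deg_zero]
    have := hS.extClass_comp
    dsimp only at this
    rw [this, Ext.zero_comp]
  · exact Ext.contravariant_sequence_exact₃ hS _ x hx (add_comm 1 j)
  · rintro ⟨e, rfl⟩
    change (Ext.mk₀ (ModuleCat.ofHom g)).comp (hS.extClass.comp e (add_comm 1 j)) (zero_add _) = 0
    have := hS.comp_extClass
    dsimp only at this
    rw [← Ext.comp_assoc (a₁₂ := 1) (h₁₂ := zero_add 1) (h₂₃ := add_comm 1 j) (h := by omega), this, Ext.zero_comp]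

end
end S13


namespace S13
section
variable {R : Type} [CommRing R]
variable {A B C : Type} [AddCommGroup A] [Module R A] [AddCommGroup B] [Module R B]
  [AddCommGroup C] [Module R C]

def kills (G M : Type) [AddCommGroup G] [Module R G]
    [AddCommGroup M] [Module R M] (j : ℕ) (r : R) : Prop :=
  ∀ e : EX R G M j, r • e = 0

variable {G : Type} [AddCommGroup G] [Module R G]
variable {M : Type} [AddCommGroup M] [Module R M]

theorem kills_of_ann {r : R} (h : ∀ m : M, r • m = 0) (j : ℕ) : kills G M j r := by
  intro e
  rw [← fmap_smul_id]
  have h0 : r • (LinearMap.id : M →ₗ[R] M) = (0:R) • LinearMap.id := by ext m; simp [h]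
  rw [h0, fmap_smul_id, zero_smul]

theorem kills_of_annG {r : R} (h : ∀ m : G, r • m = 0) (j : ℕ) : kills G M j r := by
  intro e
  rw [← gmap_smul_id]
  have h0 : r • (LinearMap.id : G →ₗ[R] G) = (0:R) • LinearMap.id := by ext m; simp [h]
  rw [h0, gmap_smul_id, zero_smul]

theorem kills.mul {j : ℕ} {r : R} (h : kills G M j r) (s : R) : kills G M j (s * r) := by
  intro e; rw [mul_smul, h, smul_zero]

theorem kills.mul' {j : ℕ} {r : R} (h : kills G M j r) (s : R) : kills G M j (r * s) := by
  intro e; rw [mul_comm, mul_smul, h, smul_zero]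

theorem kills.equiv {j : ℕ} {r : R} (h : kills G A j r) (φ : A ≃ₗ[R] B) : kills G B j r := by
  intro e
  have : e = fmap G j φ.toLinearMap (fmap G j φ.symm.toLinearMap e) := by
    rw [← fmap_comp]; simp [fmap_id]
  rw [this, ← map_smul, h, map_zero]

theorem kills.equivG {j : ℕ} {r : R} (h : kills A M j r) (φ : A ≃ₗ[R] B) : kills B M j r := by
  intro e
  have : e = gmap M j φ.symm.toLinearMap (gmap M j φ.toLinearMap e) := by
    rw [← gmap_comp]; simp [gmap_id]
  rw [this, ← map_smul, h, map_zero]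

theorem kills_sub0 {f : A →ₗ[R] B} (hf : Function.Injective f) {b : R} (hb : kills G B 0 b) :
    kills G A 0 b := by
  intro e
  apply fmap_inj0 G hf
  rw [map_smul, hb, map_zero]

section

theorem kills_sub {f : A →ₗ[R] B} {g : B →ₗ[R] C} (hf : Function.Injective f)
    (hfg : Function.Exact f g) (hg : Function.Surjective g)
    {j : ℕ} {b c : R} (hb : kills G B (j+1) b) (hc : kills G C j c) :
    kills G A (j+1) (b * c) := by
  intro e
  obtain ⟨d, h1, h2⟩ := (les G hf hfg hg).2 j
  obtain ⟨y, hy⟩ := (h2 (b • e)).1 (by rw [map_smul, hb])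
  rw [mul_comm, mul_smul, ← hy, ← map_smul, hc, map_zero]

theorem kills_mid {f : A →ₗ[R] B} {g : B →ₗ[R] C} (hf : Function.Injective f)
    (hfg : Function.Exact f g) (hg : Function.Surjective g)
    {j : ℕ} {a c : R} (ha : kills G A j a) (hc : kills G C j c) :
    kills G B j (a * c) := by
  intro e
  obtain ⟨y, hy⟩ := ((les G hf hfg hg).1 j (c • e)).1 (by rw [map_smul, hc])
  rw [mul_smul, ← hy, ← map_smul, ha, map_zero]

theorem kills_quot {f : A →ₗ[R] B} {g : B →ₗ[R] C} (hf : Function.Injective f)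
    (hfg : Function.Exact f g) (hg : Function.Surjective g)
    {j : ℕ} {a b : R} (hb : kills G B j b) (ha : kills G A (j+1) a) :
    kills G C j (a * b) := by
  intro e
  obtain ⟨d, h1, h2⟩ := (les G hf hfg hg).2 j
  obtain ⟨y, hy⟩ := (h1 (a • e)).1 (by rw [map_smul, ha])
  rw [mul_comm, mul_smul, ← hy, ← map_smul, hb, map_zero]

theorem kills_midG {f : A →ₗ[R] B} {g : B →ₗ[R] C} (hf : Function.Injective f)
    (hfg : Function.Exact f g) (hg : Function.Surjective g)
    {j : ℕ} {a c : R} (ha : kills A M j a) (hc : kills C M j c) :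
    kills B M j (a * c) := by
  intro e
  obtain ⟨y, hy⟩ := ((les' M hf hfg hg).1 j (a • e)).1 (by rw [map_smul, ha])
  rw [mul_comm, mul_smul, ← hy, ← map_smul, hc, map_zero]

end

open Pointwise in
/-- the two exact sequences attached to multiplication by `x` -/
theorem xseq (M : Type) [AddCommGroup M] [Module R M] (x : R) :
    ∃ (N : Type) (_ : AddCommGroup N) (_ : Module R N) (f : M →ₗ[R] N) (g : N →ₗ[R] M),
      Function.Surjective f ∧ Function.Injective g ∧ g.comp f = x • LinearMap.id ∧
      Function.Exact g (Submodule.mkQ (x • (⊤ : Submodule R M))) := by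
  let l : M →ₗ[R] M := x • LinearMap.id
  refine ⟨LinearMap.range l, inferInstance, inferInstance, l.rangeRestrict,
    (LinearMap.range l).subtype, l.surjective_rangeRestrict, Subtype.val_injective, ?_, ?_⟩
  · ext; simp [l]
  · rw [LinearMap.exact_iff]
    simp only [Submodule.ker_mkQ, Submodule.range_subtype]
    ext y
    simp [l, Submodule.mem_smul_pointwise_iff_exists, LinearMap.mem_range]

theorem kills_Q {x g1 : R} (hg1 : ∀ m : M, x • m = 0 → g1 • m = 0) {j : ℕ} {b c : R}
    (hb : kills G M j b) (hc : kills G M (j+1) c) : kills G (QuotSMulTop x M) j (b * c * g1) := by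
  obtain ⟨N, _, _, f, g, hf, hg, hgf, hex⟩ := xseq M x
  have hker : ∀ k, kills G (LinearMap.ker f) k g1 := fun k => kills_of_ann (by
    rintro ⟨m, hm⟩
    ext
    apply hg1
    have : g (f m) = x • m := by rw [← LinearMap.comp_apply, hgf]; rfl
    rw [← this]; rw [LinearMap.mem_ker] at hm; rw [hm, map_zero]) k
  have h1 : kills G N (j+1) (g1 * c) :=
    kills_quot (f := (LinearMap.ker f).subtype) Subtype.val_injective f.exact_subtype_ker_map hf
      hc (hker _)
  have h2 := kills_quot hg hex (Submodule.mkQ_surjective _) hb h1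
  intro e
  have := h2 e
  rwa [show b * c * g1 = g1 * c * b by ring]

theorem kills_I {x g1 : R} (hg1 : ∀ m : M, x • m = 0 → g1 • m = 0) {j : ℕ} {a : R}
    (ha : kills G (QuotSMulTop x M) j a) (e : EX R G M (j+1)) (he : x • e = 0) :
    (a * g1) • e = 0 := by
  obtain ⟨N, _, _, f, g, hf, hg, hgf, hex⟩ := xseq M x
  have hker : ∀ k, kills G (LinearMap.ker f) k g1 := fun k => kills_of_ann (by
    rintro ⟨m, hm⟩
    ext
    apply hg1
    have : g (f m) = x • m := by rw [← LinearMap.comp_apply, hgf]; rfl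
    rw [← this]; rw [LinearMap.mem_ker] at hm; rw [hm, map_zero]) k
  have h1 : fmap G (j+1) g (fmap G (j+1) f e) = 0 := by
    rw [← fmap_comp, hgf, fmap_smul_id, he]
  obtain ⟨d, -, h2⟩ := (les G hg hex (Submodule.mkQ_surjective _)).2 j
  obtain ⟨y, hy⟩ := (h2 _).1 h1
  have h3 : fmap G (j+1) f (a • e) = 0 := by
    rw [map_smul, ← hy, ← map_smul, ha, map_zero]
  obtain ⟨z, hz⟩ := ((les G (f := (LinearMap.ker f).subtype) Subtype.val_injective
    f.exact_subtype_ker_map hf).1 (j+1) _).1 h3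
  rw [mul_comm, mul_smul, ← hz, ← map_smul, hker, map_zero]

theorem kills_I0 {x g1 : R} (hg1 : ∀ m : M, x • m = 0 → g1 • m = 0)
    (e : EX R G M 0) (he : x • e = 0) : g1 • e = 0 := by
  obtain ⟨N, _, _, f, g, hf, hg, hgf, hex⟩ := xseq M x
  have hker : ∀ k, kills G (LinearMap.ker f) k g1 := fun k => kills_of_ann (by
    rintro ⟨m, hm⟩
    ext
    apply hg1
    have : g (f m) = x • m := by rw [← LinearMap.comp_apply, hgf]; rfl
    rw [← this]; rw [LinearMap.mem_ker] at hm; rw [hm, map_zero]) k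
  have h3 : fmap G 0 f e = 0 := by
    apply fmap_inj0 G hg
    rw [← fmap_comp, hgf, fmap_smul_id, he, map_zero]
  obtain ⟨z, hz⟩ := ((les G (f := (LinearMap.ker f).subtype) Subtype.val_injective
    f.exact_subtype_ker_map hf).1 0 _).1 h3
  rw [← hz, ← map_smul, hker, map_zero]

instance [IsNoetherianRing R] [Module.Finite R G] [Module.Finite R M] (j : ℕ) :
    Module.Finite R (EX R G M j) := ModuleCat.finite_ext R (ModuleCat.of R G) (ModuleCat.of R M) j

/-! ### Uniform annihilators -/

def KillAt (j t : ℕ) (M : Type) [AddCommGroup M] [Module R M] (r : R) : Prop :=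
  ∀ (G : Type) [AddCommGroup G] [Module R G] (n : ℕ),
    (∀ k < n, Subsingleton (EX R G R k)) → j + t < n → kills G M j r

def Kill (t : ℕ) (M : Type) [AddCommGroup M] [Module R M] (r : R) : Prop :=
  ∀ j, KillAt j t M r

theorem KillAt.mono {j t t' : ℕ} (h : t ≤ t') {r : R} (hr : KillAt j t M r) : KillAt j t' M r :=
  fun G _ _ n hn hj => hr G n hn (by omega)

theorem Kill.mono {t t' : ℕ} (h : t ≤ t') {r : R} (hr : Kill t M r) : Kill t' M r :=
  fun j => (hr j).mono h

theorem KillAt.of_ann {j t : ℕ} {r : R} (h : ∀ m : M, r • m = 0) : KillAt j t M r :=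
  fun _ _ _ _ _ _ => kills_of_ann h j

theorem Kill.of_ann {t : ℕ} {r : R} (h : ∀ m : M, r • m = 0) : Kill t M r :=
  fun _ => KillAt.of_ann h

theorem KillAt.mul {j t : ℕ} {r : R} (h : KillAt j t M r) (s : R) : KillAt j t M (s * r) :=
  fun G _ _ n hn hj => (h G n hn hj).mul s

theorem KillAt.mul' {j t : ℕ} {r : R} (h : KillAt j t M r) (s : R) : KillAt j t M (r * s) :=
  fun G _ _ n hn hj => (h G n hn hj).mul' s

theorem KillAt.equiv {j t : ℕ} {r : R} (h : KillAt j t A r) (φ : A ≃ₗ[R] B) : KillAt j t B r :=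
  fun G _ _ n hn hj => (h G n hn hj).equiv φ

def killIdeal (t : ℕ) (M : Type) [AddCommGroup M] [Module R M] : Ideal R where
  carrier := {r | Kill t M r}
  add_mem' := by
    intro a b ha hb j G _ _ n hn hj e
    rw [add_smul, ha j G n hn hj, hb j G n hn hj, add_zero]
  zero_mem' := by
    intro j G _ _ n hn hj e
    rw [zero_smul]
  smul_mem' := by
    intro c a ha j
    exact (ha j).mul c

theorem mem_killIdeal {t : ℕ} {r : R} : r ∈ killIdeal t M ↔ Kill t M r := Iff.rfl

theorem Kill_ring : Kill 0 R (1:R) := by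
  intro j G _ _ n hn hj e
  have := hn j (by omega)
  exact Subsingleton.elim _ _

section

theorem KillAt_sub {f : A →ₗ[R] B} {g : B →ₗ[R] C} (hf : Function.Injective f)
    (hfg : Function.Exact f g) (hg : Function.Surjective g)
    {j t : ℕ} {b c : R} (hb : KillAt (j+1) t B b) (hc : KillAt j (t+1) C c) :
    KillAt (j+1) t A (b * c) := fun G _ _ n hn hj =>
  kills_sub hf hfg hg (hb G n hn hj) (hc G n hn (by omega))

theorem KillAt_mid {f : A →ₗ[R] B} {g : B →ₗ[R] C} (hf : Function.Injective f)
    (hfg : Function.Exact f g) (hg : Function.Surjective g)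
    {j t : ℕ} {a c : R} (ha : KillAt j t A a) (hc : KillAt j t C c) :
    KillAt j t B (a * c) := fun G _ _ n hn hj =>
  kills_mid hf hfg hg (ha G n hn hj) (hc G n hn hj)

theorem KillAt_quot {f : A →ₗ[R] B} {g : B →ₗ[R] C} (hf : Function.Injective f)
    (hfg : Function.Exact f g) (hg : Function.Surjective g)
    {j t : ℕ} {a b : R} (hb : KillAt j (t+1) B b) (ha : KillAt (j+1) t A a) :
    KillAt j (t+1) C (a * b) := fun G _ _ n hn hj =>
  kills_quot hf hfg hg (hb G n hn hj) (ha G n hn (by omega))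

theorem KillAt_quot_ann {f : A →ₗ[R] B} {g : B →ₗ[R] C} (hf : Function.Injective f)
    (hfg : Function.Exact f g) (hg : Function.Surjective g)
    {j t : ℕ} {a b : R} (hb : KillAt j t B b) (ha : ∀ m : A, a • m = 0) :
    KillAt j t C (a * b) := fun G _ _ n hn hj =>
  kills_quot hf hfg hg (hb G n hn hj) (kills_of_ann ha _)

end

theorem KillAt_sub0 {f : A →ₗ[R] B} (hf : Function.Injective f) {t : ℕ} {b : R}
    (hb : KillAt 0 t B b) : KillAt 0 t A b := fun G _ _ n hn hj =>
  kills_sub0 hf (hb G n hn hj)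

theorem Kill_QuotSMulTop {x g1 : R} (hg1 : ∀ m : M, x • m = 0 → g1 • m = 0) {t : ℕ} {b : R}
    (hb : Kill t M b) : Kill (t+1) (QuotSMulTop x M) (b * b * g1) := fun j G _ _ n hn hj =>
  kills_Q hg1 (hb j G n hn (by omega)) (hb (j+1) G n hn (by omega))

/-- if `g x^k` kills and `M/xM` is uniformly killed by `a` then `(a g1)^k g` kills. -/
theorem Kill_of_quot {x g1 a : R} (hg1 : ∀ m : M, x • m = 0 → g1 • m = 0) {t : ℕ}
    (ha : Kill (t+1) (QuotSMulTop x M) a) {g : R} {k : ℕ} (hk : Kill t M (g * x ^ k)) :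
    Kill t M ((a * g1) ^ k * g) := by
  have key : ∀ j G [AddCommGroup G] [Module R G] (n : ℕ),
    (∀ k < n, Subsingleton (EX R G R k)) → j + t < n → ∀ e : EX R G M j, x • e = 0 →
      (a * g1) • e = 0 := by
    intro j G _ _ n hn hj e he
    cases j with
    | zero => rw [mul_smul, kills_I0 hg1 e he, smul_zero]
    | succ j => exact kills_I hg1 (ha j G n hn (by omega)) e he
  intro j G _ _ n hn hj e
  have h0 := hk j G n hn hj e
  rw [mul_comm, mul_smul] at h0
  rw [mul_smul]
  generalize g • e = e' at *
  clear hk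
  induction k generalizing e' with
  | zero => simpa using h0
  | succ k ih =>
    rw [pow_succ, mul_smul] at h0 ⊢
    have := ih (x • e') h0
    rw [smul_comm] at this
    rw [smul_comm]
    exact key j G n hn hj _ this

end
end S13


namespace S13
section
variable {R : Type} [CommRing R] [IsNoetherianRing R]

theorem devissage (I : Ideal R)
    (Q : (N : Type) → [AddCommGroup N] → [Module R N] → Prop)
    (hsub : ∀ (N : Type) [AddCommGroup N] [Module R N], Subsingleton N → Q N)
    (hequiv : ∀ (N N' : Type) [AddCommGroup N] [Module R N] [AddCommGroup N'] [Module R N'],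
      (N ≃ₗ[R] N') → Q N → Q N')
    (hext : ∀ (A B C : Type) [AddCommGroup A] [Module R A] [AddCommGroup B] [Module R B]
      [AddCommGroup C] [Module R C] (f : A →ₗ[R] B) (g : B →ₗ[R] C), Function.Injective f →
      Function.Exact f g → Function.Surjective g → Q A → Q C → Q B)
    (hprime : ∀ q : Ideal R, q.IsPrime → I ≤ q → Q (R ⧸ q))
    (M : Type) [AddCommGroup M] [Module R M] [hM : Module.Finite R M]
    (hI : ∀ r ∈ I, ∀ m : M, r • m = 0) : Q M := by
  refine IsNoetherianRing.induction_on_isQuotientEquivQuotientPrime R hM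
    (motive := fun N [AddCommGroup N] [Module R N] [Module.Finite R N] =>
      (∀ r ∈ I, ∀ m : N, r • m = 0) → Q N) ?_ ?_ ?_ hI
  · intro N _ _ _ hN _; exact hsub N hN
  · intro N _ _ _ q e h
    refine hequiv _ _ e.symm (hprime q.1 q.2 ?_)
    intro r hr
    have := h r hr (e.symm 1)
    rw [← map_smul, e.symm.map_eq_zero_iff] at this
    rwa [← Ideal.Quotient.eq_zero_iff_mem, ← mul_one r, map_mul]
  · intro A _ _ _ B _ _ _ C _ _ _ f g hf hg hfg hA hC h
    refine hext A B C f g hf hfg hg (hA ?_) (hC ?_)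
    · intro r hr m; apply hf; rw [map_smul, h r hr, map_zero]
    · intro r hr m; obtain ⟨b, rfl⟩ := hg m; rw [← map_smul, h r hr, map_zero]

theorem exists_pow_of_minimal {K p : Ideal R} (hp : p ∈ K.minimalPrimes) {x : R} (hx : x ∈ p) :
    ∃ g ∉ p, ∃ k : ℕ, g * x ^ k ∈ K := by
  have hpp : p.IsPrime := hp.isPrime
  by_contra! h
  obtain ⟨q, hq, hKq, hd⟩ := Ideal.exists_le_prime_disjoint K
    (p.primeCompl ⊔ Submonoid.powers x) (by
      rw [Set.disjoint_left]
      intro y hy hy'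
      obtain ⟨g, hg, z, ⟨k, rfl⟩, rfl⟩ := Submonoid.mem_sup.1 hy'
      exact h g hg k hy)
  rw [Set.disjoint_left] at hd
  have hqp : q ≤ p := by
    intro y hy
    by_contra hyp
    exact hd hy (Submonoid.mem_sup_left hyp)
  exact hd (hp.2 ⟨hq, hKq⟩ hqp hx) (Submonoid.mem_sup_right (Submonoid.mem_powers x))

theorem exists_minimal_le {K p : Ideal R} [p.IsPrime] (h : K ≤ p) :
    ∃ p' ∈ K.minimalPrimes, p' ≤ p := Ideal.exists_minimalPrimes_le h

theorem quot_ann (q : Ideal R) {r : R} (hr : r ∈ q) (m : R ⧸ q) : r • m = 0 := by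
  obtain ⟨m, rfl⟩ := Ideal.Quotient.mk_surjective m
  rw [← Ideal.Quotient.mk_eq_mk, ← Submodule.Quotient.mk_smul, Submodule.Quotient.mk_eq_zero]
  exact q.mul_mem_right _ hr

theorem devD {I p : Ideal R} [hp : p.IsPrime] (h : ∀ q : Ideal R, q.IsPrime → I ≤ q → q ≤ p → q = p)
    (C : Type) [AddCommGroup C] [Module R C] [Module.Finite R C]
    (hI : ∀ r ∈ I, ∀ m : C, r • m = 0) :
    ∃ s ∉ p, ∃ r : ℕ, ∀ j t a, KillAt j t (R ⧸ p) a → KillAt j t C (s * a ^ r) := by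
  have h1 : (1:R) ∉ p := fun h => hp.ne_top (p.eq_top_iff_one.2 h)
  refine devissage I (fun C _ _ =>
    ∃ s ∉ p, ∃ r : ℕ, ∀ j t a, KillAt j t (R ⧸ p) a → KillAt j t C (s * a ^ r))
    ?_ ?_ ?_ ?_ C hI
  · intro N _ _ _
    exact ⟨1, h1, 0, fun j t a _ => KillAt.of_ann (fun m => Subsingleton.elim _ _)⟩
  · rintro N N' _ _ _ _ e ⟨s, hs, r, H⟩
    exact ⟨s, hs, r, fun j t a ha => (H j t a ha).equiv e⟩
  · rintro A B C _ _ _ _ _ _ f g hf hfg hg ⟨s, hs, r, H⟩ ⟨s', hs', r', H'⟩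
    refine ⟨s * s', fun hh => (hp.mem_or_mem hh).elim hs hs', r + r', fun j t a ha => ?_⟩
    have := KillAt_mid hf hfg hg (H j t a ha) (H' j t a ha)
    rwa [show s * s' * a ^ (r + r') = s * a ^ r * (s' * a ^ r') by ring]
  · intro q hq hIq
    by_cases hqp : q ≤ p
    · obtain rfl := h q hq hIq hqp
      exact ⟨1, h1, 1, fun j t a ha => by simpa using ha⟩
    · obtain ⟨s, hsq, hsp⟩ := Set.not_subset.1 hqp
      exact ⟨s, hsp, 0, fun j t a ha => KillAt.of_ann (fun m => by
        rw [pow_zero, mul_one]; exact quot_ann q hsq m)⟩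

/-! ### Heights -/

noncomputable def ht (p : Ideal R) : ℕ := p.height.toNat

theorem coe_ht (p : Ideal R) [hp : p.IsPrime] : (ht p : ℕ∞) = p.height :=
  ENat.natCast_toNat (Ideal.height_ne_top hp.ne_top)

theorem ht_lt {p q : Ideal R} [p.IsPrime] [q.IsPrime] (h : p < q) : ht p < ht q := by
  have := Ideal.height_add_one_le_of_lt_of_isPrime h
  rw [← coe_ht, ← coe_ht] at this
  have : ht p + 1 ≤ ht q := by exact_mod_cast this
  omega

theorem ht_le {p q : Ideal R} [p.IsPrime] [q.IsPrime] (h : p ≤ q) : ht p ≤ ht q := by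
  rcases h.eq_or_lt with rfl | h
  · exact le_rfl
  · exact (ht_lt h).le

/-! ### Sequences -/

/-- elements of `p` that become a weakly regular sequence on `M` after localizing at `p`. -/
def SeqAt (p : Ideal R) : ℕ → (M : Type) → [AddCommGroup M] → [Module R M] → Prop
  | 0, _, _, _ => True
  | n + 1, M, _, _ => ∃ x ∈ p, (∃ g ∉ p, ∀ m : M, x • m = 0 → g • m = 0) ∧
      SeqAt p n (QuotSMulTop x M)

theorem assoc_of_minimal {M : Type} [AddCommGroup M] [Module R M] [Module.Finite R M]
    {q : Ideal R} (hq : q ∈ (Module.annihilator R M).minimalPrimes) :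
    ∃ m : M, ∀ r, r ∈ q ↔ r • m = 0 := by
  have := Module.associatedPrimes.minimalPrimes_annihilator_subset_associatedPrimes R M hq
  obtain ⟨-, m, hm⟩ := isAssociatedPrime_iff.1 this
  exact ⟨m, fun r => by rw [hm, Submodule.mem_colon_singleton, Submodule.mem_bot]⟩

theorem ann_quot_le {M : Type} [AddCommGroup M] [Module R M] [Module.Finite R M]
    {p : Ideal R} [hp : p.IsPrime] {x : R} :
    Module.annihilator R (QuotSMulTop x M) ≤ p ↔ Module.annihilator R M ≤ p ∧ x ∈ p := by
  have h1 := Module.support_quotSMulTop (R := R) (M := M) x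
  rw [Module.support_eq_zeroLocus, Module.support_eq_zeroLocus] at h1
  have := Set.ext_iff.1 h1 ⟨p, hp⟩
  simpa [PrimeSpectrum.mem_zeroLocus] using this

theorem seq_quot (p : Ideal R) [hp : p.IsPrime] (n : ℕ) :
    ∀ (M : Type) [AddCommGroup M] [Module R M] [Module.Finite R M], SeqAt p n M →
    ∃ (W : Type) (_ : AddCommGroup W) (_ : Module R W) (_ : Module.Finite R W),
      (∀ t, ∀ b ∉ p, Kill t M b → ∃ w ∉ p, Kill (t + n) W w) ∧
      (Module.annihilator R M ≤ p → Module.annihilator R W ≤ p) ∧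
      (∀ h : ℕ, (∀ q : Ideal R, q.IsPrime → q ≤ p → Module.annihilator R M ≤ q → h ≤ ht q) →
        (∀ q : Ideal R, q.IsPrime → q ≤ p → Module.annihilator R W ≤ q → h + n ≤ ht q)) := by
  induction n with
  | zero =>
    intro M _ _ _ _
    exact ⟨M, inferInstance, inferInstance, inferInstance, fun t b hb hk => ⟨b, hb, hk⟩, id,
      fun h H => H⟩
  | succ n ih =>
    rintro M _ _ _ ⟨x, hx, ⟨g, hg, hgx⟩, hseq⟩
    obtain ⟨W, _, _, _, h1, h2, h3⟩ := ih (QuotSMulTop x M) hseq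
    refine ⟨W, inferInstance, inferInstance, inferInstance, ?_, ?_, ?_⟩
    · intro t b hb hk
      obtain ⟨w, hw, hw'⟩ := h1 (t+1) (b * b * g) (fun hh => by
        rcases hp.mem_or_mem hh with hh | hh
        · exact (hp.mem_or_mem hh).elim hb hb
        · exact hg hh) (Kill_QuotSMulTop hgx hk)
      exact ⟨w, hw, by rwa [show t + (n+1) = t + 1 + n by ring]⟩
    · intro hM; exact h2 (ann_quot_le.2 ⟨hM, hx⟩)
    · intro h H q hq hqp hWq
      have := h3 (h+1) (fun q hq hqp hq' => by
        obtain ⟨hMq, hxq⟩ := ann_quot_le.1 hq'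
        obtain ⟨q0, hq0, hle⟩ := exists_minimal_le hMq
        have hq0p : q0.IsPrime := hq0.isPrime
        obtain ⟨m, hm⟩ := assoc_of_minimal hq0
        have hlt : q0 < q := by
          refine lt_of_le_of_ne hle ?_
          rintro rfl
          exact hg (hqp ((hm g).2 (hgx m ((hm x).1 hxq))))
        have h5 := H q0 hq0p (hle.trans hqp) hq0.1.2
        have := ht_lt hlt
        omega) q hq hqp hWq
      omega

end
end S13


namespace S13
section
variable {R : Type} [CommRing R] [IsNoetherianRing R]

theorem one_nmem (p : Ideal R) [hp : p.IsPrime] : (1:R) ∉ p :=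
  fun h => hp.ne_top (p.eq_top_iff_one.2 h)

theorem pow_nmem {p : Ideal R} [hp : p.IsPrime] {a : R} (ha : a ∉ p) (n : ℕ) : a ^ n ∉ p :=
  fun h => ha (hp.mem_of_pow_mem n h)

theorem mul_nmem {p : Ideal R} [hp : p.IsPrime] {a b : R} (ha : a ∉ p) (hb : b ∉ p) : a * b ∉ p :=
  fun h => (hp.mem_or_mem h).elim ha hb

def CMH (R : Type) [CommRing R] [IsNoetherianRing R] : Prop :=
  ∀ p : Ideal R, p.IsPrime → SeqAt p (ht p) R

theorem stepA (h : CMH R) (p : Ideal R) [hp : p.IsPrime] :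
    ∃ w ∉ p, ∃ r : ℕ, ∀ t, ht p ≤ t → KillAt 0 t (R ⧸ p) w ∧
      ∀ j a, KillAt j (t+1) (R ⧸ p) a → KillAt (j+1) t (R ⧸ p) (w * a ^ r) := by
  obtain ⟨W, _, _, _, h1, h2, h3⟩ := seq_quot p (ht p) R (h p hp)
  obtain ⟨w, hw, hkw⟩ := h1 0 1 (one_nmem p) Kill_ring
  rw [zero_add] at hkw
  have hWp : Module.annihilator R W ≤ p := h2 (by
    intro r hr
    have := Module.mem_annihilator.1 hr (1:R)
    simp only [smul_eq_mul, mul_one] at this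
    rw [this]; exact p.zero_mem)
  have hmin : ∀ q : Ideal R, q.IsPrime → Module.annihilator R W ≤ q → q ≤ p → q = p := by
    intro q hq hWq hqp
    by_contra hne
    have := ht_lt (lt_of_le_of_ne hqp hne)
    have := h3 0 (fun _ _ _ _ => Nat.zero_le _) q hq hqp hWq
    omega
  obtain ⟨q, hq, hqp⟩ := exists_minimal_le hWp
  obtain rfl := hmin q hq.isPrime hq.1.2 hqp
  obtain ⟨m, hm⟩ := assoc_of_minimal hq
  let f : (R ⧸ q) →ₗ[R] W := Submodule.liftQ q (LinearMap.toSpanSingleton R W m) (by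
    intro r hr; exact (hm r).1 hr)
  have hf : Function.Injective f := by
    rw [injective_iff_map_eq_zero]
    intro a ha
    obtain ⟨a, rfl⟩ := Submodule.Quotient.mk_surjective _ a
    rw [Submodule.Quotient.mk_eq_zero]
    exact (hm a).2 ha
  have hg := Submodule.mkQ_surjective (LinearMap.range f)
  have hfg : Function.Exact f (LinearMap.range f).mkQ := by
    rw [LinearMap.exact_iff, Submodule.ker_mkQ]
  obtain ⟨s, hs, r, hC⟩ := devD (p := q) hmin (W ⧸ LinearMap.range f) (by
    intro r hr m
    obtain ⟨m, rfl⟩ := hg m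
    rw [← map_smul, Module.mem_annihilator.1 hr m, map_zero])
  refine ⟨w * s, mul_nmem hw hs, r, fun t ht' => ⟨?_, fun j a ha => ?_⟩⟩
  · exact (KillAt_sub0 hf ((hkw 0).mono ht')).mul' s
  · have := KillAt_sub hf hfg hg ((hkw (j+1)).mono ht') (hC j (t+1) a ha)
    rwa [mul_assoc]

theorem stepA' (h : CMH R) (p : Ideal R) [hp : p.IsPrime] :
    ∃ s ∉ p, ∀ j, ∃ N : ℕ, KillAt j (ht p) (R ⧸ p) (s ^ N) := by
  obtain ⟨w, hw, r, H⟩ := stepA h p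
  refine ⟨w, hw, fun j => ?_⟩
  induction j with
  | zero => exact ⟨1, by simpa using (H _ le_rfl).1⟩
  | succ j ih =>
    obtain ⟨N, hN⟩ := ih
    refine ⟨1 + N * r, ?_⟩
    rw [pow_add, pow_one, pow_mul]
    exact (H _ le_rfl).2 j _ (hN.mono (Nat.le_succ _))

theorem stepA'' (h : CMH R) (p : Ideal R) [hp : p.IsPrime] (t : ℕ) (htp : ht p ≤ t)
    (hK : ∃ a ∉ p, Kill (t + 1) (R ⧸ p) a) : ∃ a ∉ p, Kill t (R ⧸ p) a := by
  obtain ⟨w, hw, r, H⟩ := stepA h p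
  obtain ⟨a, ha, hk⟩ := hK
  refine ⟨w * a ^ r, mul_nmem hw (pow_nmem ha r), fun j => ?_⟩
  cases j with
  | zero => exact (H t htp).1.mul' _
  | succ j => exact (H t htp).2 j a (hk j)

/-- Noetherian induction on primes. -/
theorem prime_induction {P : (q : Ideal R) → Prop}
    (H : ∀ q : Ideal R, q.IsPrime → (∀ q', q'.IsPrime → q < q' → P q') → P q)
    (q : Ideal R) (hq : q.IsPrime) : P q := by
  revert hq
  induction q using (wellFounded_gt (α := Ideal R)).induction with
  | _ q ih => exact fun hq => H q hq (fun q' hq' hlt => ih q' hlt hq')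

theorem regular_quot {q : Ideal R} [hq : q.IsPrime] {x : R} (hx : x ∉ q) (m : R ⧸ q)
    (hm : x • m = 0) : m = 0 := by
  obtain ⟨m, rfl⟩ := Ideal.Quotient.mk_surjective m
  rw [← Ideal.Quotient.mk_eq_mk, ← Submodule.Quotient.mk_smul, Submodule.Quotient.mk_eq_zero] at hm
  rw [Ideal.Quotient.eq_zero_iff_mem]
  exact (hq.mem_or_mem hm).resolve_left hx

theorem quotSMul_ann {q : Ideal R} (x : R) (r : R) (hr : r ∈ q ⊔ Ideal.span {x})
    (m : QuotSMulTop x (R ⧸ q)) : r • m = 0 := by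
  obtain ⟨m, rfl⟩ := Submodule.Quotient.mk_surjective _ m
  obtain ⟨a, ha, b, hb, rfl⟩ := Submodule.mem_sup.1 hr
  obtain ⟨c, rfl⟩ := Ideal.mem_span_singleton'.1 hb
  rw [← Submodule.Quotient.mk_smul, Submodule.Quotient.mk_eq_zero, add_smul, quot_ann q ha,
    zero_add, mul_comm, mul_smul]
  exact Submodule.smul_mem_pointwise_smul _ _ _ trivial

theorem lt_of_sup_le {q q' : Ideal R} {x : R} (hx : x ∉ q) (h : q ⊔ Ideal.span {x} ≤ q') :
    q < q' := by
  refine lt_of_le_of_ne (le_sup_left.trans h) ?_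
  rintro rfl
  exact hx (h (Ideal.mem_sup_right (Ideal.mem_span_singleton_self x)))

/-- dévissage for `Kill t _ 1` -/
theorem dev_one (I : Ideal R)
    (hq : ∀ q : Ideal R, q.IsPrime → I ≤ q → ∃ h, Kill h (R ⧸ q) (1:R))
    (M : Type) [AddCommGroup M] [Module R M] [Module.Finite R M]
    (hI : ∀ r ∈ I, ∀ m : M, r • m = 0) : ∃ h, Kill h M (1:R) := by
  refine devissage I (fun M _ _ => ∃ h, Kill h M (1:R)) ?_ ?_ ?_ hq M hI
  · intro N _ _ _
    exact ⟨0, Kill.of_ann (fun m => Subsingleton.elim _ _)⟩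
  · rintro N N' _ _ _ _ e ⟨h, H⟩
    exact ⟨h, fun j => (H j).equiv e⟩
  · rintro A B C _ _ _ _ _ _ f g hf hfg hg ⟨h, H⟩ ⟨h', H'⟩
    refine ⟨max h h', fun j => ?_⟩
    have := KillAt_mid hf hfg hg ((H j).mono (le_max_left h h')) ((H' j).mono (le_max_right h h'))
    simpa using this

theorem dev_kill (I p : Ideal R) [hp : p.IsPrime] (t : ℕ)
    (hq : ∀ q : Ideal R, q.IsPrime → I ≤ q → q ≤ p → ∃ a ∉ p, Kill t (R ⧸ q) a)
    (M : Type) [AddCommGroup M] [Module R M] [Module.Finite R M]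
    (hI : ∀ r ∈ I, ∀ m : M, r • m = 0) : ∃ a ∉ p, Kill t M a := by
  refine devissage I (fun M _ _ => ∃ a ∉ p, Kill t M a) ?_ ?_ ?_ ?_ M hI
  · intro N _ _ _
    exact ⟨1, one_nmem p, Kill.of_ann (fun m => Subsingleton.elim _ _)⟩
  · rintro N N' _ _ _ _ e ⟨a, ha, H⟩
    exact ⟨a, ha, fun j => (H j).equiv e⟩
  · rintro A B C _ _ _ _ _ _ f g hf hfg hg ⟨h, hh, H⟩ ⟨h', hh', H'⟩
    exact ⟨h * h', mul_nmem hh hh', fun j => KillAt_mid hf hfg hg (H j) (H' j)⟩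
  · intro q hq' hIq
    by_cases hqp : q ≤ p
    · exact hq q hq' hIq hqp
    · obtain ⟨s, hsq, hsp⟩ := Set.not_subset.1 hqp
      exact ⟨s, hsp, Kill.of_ann (fun m => quot_ann q hsq m)⟩

theorem lemmaW (h : CMH R) (q : Ideal R) (hq : q.IsPrime) : ∃ k, Kill k (R ⧸ q) (1:R) := by
  refine prime_induction (P := fun q => ∃ k, Kill k (R ⧸ q) (1:R)) ?_ q hq
  intro q hq ih
  obtain ⟨s, hs, H⟩ := stepA' h q
  obtain ⟨k, hk⟩ := dev_one (q ⊔ Ideal.span {s}) (fun q' hq' hle => ih q' hq' (lt_of_sup_le hs hle))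
    (QuotSMulTop s (R ⧸ q)) (quotSMul_ann s)
  refine ⟨max (ht q) k, fun j G _ _ n hn hj => ?_⟩
  have hreg : ∀ m : R ⧸ q, s • m = 0 → (1:R) • m = 0 := fun m hm => by
    rw [one_smul]; exact regular_quot hs m hm
  have key : ∀ e : EX R G (R ⧸ q) j, s • e = 0 → e = 0 := by
    intro e he
    cases j with
    | zero => simpa using kills_I0 hreg e he
    | succ j =>
      have := kills_I hreg (hk j G n hn (by have := le_max_right (ht q) k; omega)) e he
      simpa using this
  obtain ⟨N, hN⟩ := H j
  intro e
  rw [one_smul]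
  have h0 := hN G n hn (by have := le_max_left (ht q) k; omega) e
  clear hN
  induction N with
  | zero => simpa using h0
  | succ N ih =>
    apply ih
    apply key
    rw [smul_smul, ← pow_succ']
    exact h0

theorem lemmaC (h : CMH R) (p : Ideal R) [hp : p.IsPrime] : ∃ a ∉ p, Kill (ht p) (R ⧸ p) a := by
  obtain ⟨k, hk⟩ := lemmaW h p hp
  have : ∀ d, ∃ a ∉ p, Kill (ht p + (k - d)) (R ⧸ p) a := by
    intro d
    induction d with
    | zero => exact ⟨1, one_nmem p, hk.mono (by omega)⟩
    | succ d ih =>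
      by_cases hd : d < k
      · refine stepA'' h p _ (by omega) ?_
        rwa [show ht p + (k - (d+1)) + 1 = ht p + (k - d) by omega]
      · rwa [show k - (d+1) = k - d by omega]
  simpa using this k

theorem claimD (h : CMH R) (q : Ideal R) (hq : q.IsPrime) : ∀ (p : Ideal R) [p.IsPrime] (u : ℕ),
    q ≤ p → ht p ≤ u → ∃ a ∉ p, Kill u (R ⧸ q) a := by
  refine prime_induction (P := fun q => ∀ (p : Ideal R) [p.IsPrime] (u : ℕ),
    q ≤ p → ht p ≤ u → ∃ a ∉ p, Kill u (R ⧸ q) a) ?_ q hq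
  intro q hq ih p hp u hqp hu
  by_contra! hcon
  have hK : killIdeal u (R ⧸ q) ≤ p := by
    intro a ha
    by_contra hap
    exact hcon a hap ha
  obtain ⟨p', hp', hle⟩ := exists_minimal_le hK
  have hpp : p'.IsPrime := hp'.isPrime
  have hqp' : q ≤ p' := fun r hr => hp'.1.2 (Kill.of_ann (fun m => quot_ann q hr m))
  have hne : q ≠ p' := by
    rintro rfl
    obtain ⟨a, ha, hka⟩ := lemmaC h q
    exact ha (hp'.1.2 (hka.mono ((ht_le hle).trans hu)))
  obtain ⟨x, hxp, hxq⟩ := Set.not_subset.1 (fun hh : p' ≤ q => hne (le_antisymm hqp' hh))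
  obtain ⟨a, ha, hka⟩ := dev_kill (q ⊔ Ideal.span {x}) p' (u+1) (fun q' hq' h1 h2 =>
    ih q' hq' (lt_of_sup_le hxq h1) p' (u+1) h2 (by have := ht_le hle; omega))
    (QuotSMulTop x (R ⧸ q)) (quotSMul_ann x)
  obtain ⟨g, hg, k, hk⟩ := exists_pow_of_minimal hp' hxp
  have := Kill_of_quot (g1 := 1) (fun m hm => by rw [one_smul]; exact regular_quot hxq m hm) hka hk
  refine mul_nmem (pow_nmem ?_ k) hg (hp'.1.2 this)
  rwa [mul_one]

theorem lemmaE0 (h : CMH R) (p : Ideal R) [hp : p.IsPrime]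
    (M : Type) [AddCommGroup M] [Module R M] [Module.Finite R M] : ∃ a ∉ p, Kill (ht p) M a :=
  dev_kill ⊥ p (ht p) (fun q hq _ hqp => claimD h q hq p _ hqp le_rfl) M (by
    intro r hr m; rw [(Submodule.mem_bot _).1 hr, zero_smul])

end
end S13


namespace S13
section
variable {R : Type} [CommRing R] [IsNoetherianRing R]

def ExtAt (p : Ideal R) (d : ℕ) (M : Type) [AddCommGroup M] [Module R M] : Prop :=
  ∀ i < d, ∃ g ∉ p, kills (R ⧸ p) M i g

theorem ExtAt_of_SeqAt (p : Ideal R) [hp : p.IsPrime] (d : ℕ) :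
    ∀ (M : Type) [AddCommGroup M] [Module R M], SeqAt p d M → ExtAt p d M := by
  induction d with
  | zero => intro M _ _ _ i hi; omega
  | succ d ih =>
    rintro M _ _ ⟨x, hx, ⟨g, hg, hgx⟩, hseq⟩ i hi
    have hxk : ∀ k, kills (R ⧸ p) M k x := kills_of_annG (fun m => quot_ann p hx m)
    cases i with
    | zero => exact ⟨g, hg, fun e => kills_I0 hgx e (hxk 0 e)⟩
    | succ i =>
      obtain ⟨a, ha, hk⟩ := ih _ hseq i (by omega)
      exact ⟨a * g, mul_nmem ha hg, fun e => kills_I hgx hk e (hxk _ e)⟩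

theorem nakayama {E : Type} [AddCommGroup E] [Module R E] [Module.Finite R E]
    {p : Ideal R} [hp : p.IsPrime] {x g : R} (hx : x ∈ p) (hg : g ∉ p)
    (H : ∀ e : E, ∃ e' : E, g • e = x • e') : ∃ g' ∉ p, ∀ e : E, g' • e = 0 := by
  by_contra! hcon
  have h1 : Module.annihilator R E ≤ p := by
    intro r hr
    by_contra hrp
    obtain ⟨e, he⟩ := hcon r hrp
    exact he (Module.mem_annihilator.1 hr e)
  have h2 := ann_quot_le.2 ⟨h1, hx⟩
  apply hg
  apply h2
  rw [Module.mem_annihilator]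
  intro m
  obtain ⟨m, rfl⟩ := Submodule.Quotient.mk_surjective _ m
  obtain ⟨e', he'⟩ := H m
  rw [← Submodule.Quotient.mk_smul, Submodule.Quotient.mk_eq_zero, he']
  exact Submodule.smul_mem_pointwise_smul _ _ _ trivial

theorem dev_killG (I p : Ideal R) [hp : p.IsPrime]
    (M : Type) [AddCommGroup M] [Module R M] (i : ℕ)
    (hq : ∀ q : Ideal R, q.IsPrime → I ≤ q → q ≤ p → ∃ a ∉ p, kills (R ⧸ q) M i a)
    (G : Type) [AddCommGroup G] [Module R G] [Module.Finite R G]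
    (hI : ∀ r ∈ I, ∀ m : G, r • m = 0) : ∃ a ∉ p, kills G M i a := by
  refine devissage I (fun G _ _ => ∃ a ∉ p, kills G M i a) ?_ ?_ ?_ ?_ G hI
  · intro N _ _ _
    exact ⟨1, one_nmem p, kills_of_annG (fun m => Subsingleton.elim _ _) _⟩
  · rintro N N' _ _ _ _ e ⟨a, ha, H⟩
    exact ⟨a, ha, H.equivG e⟩
  · rintro A B C _ _ _ _ _ _ f g hf hfg hg ⟨h, hh, H⟩ ⟨h', hh', H'⟩
    exact ⟨h * h', mul_nmem hh hh', kills_midG hf hfg hg H H'⟩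
  · intro q hq' hIq
    by_cases hqp : q ≤ p
    · exact hq q hq' hIq hqp
    · obtain ⟨s, hsq, hsp⟩ := Set.not_subset.1 hqp
      exact ⟨s, hsp, kills_of_annG (fun m => quot_ann q hsq m) _⟩

open Pointwise in
theorem ischebeck (p : Ideal R) [hp : p.IsPrime] (n : ℕ)
    (M : Type) [AddCommGroup M] [Module R M] [Module.Finite R M] (hM : ExtAt p n M)
    (q : Ideal R) (hq : q.IsPrime) (hqp : q ≤ p) (i : ℕ) (hi : i + (ht p - ht q) < n) :
    ∃ g ∉ p, kills (R ⧸ q) M i g := by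
  revert hqp i hi
  refine prime_induction (P := fun q => q ≤ p → ∀ i, i + (ht p - ht q) < n →
    ∃ g ∉ p, kills (R ⧸ q) M i g) ?_ q hq
  intro q hq ih hqp i hi
  by_cases hne : q = p
  · subst hne
    exact hM i (by omega)
  have hlt := lt_of_le_of_ne hqp hne
  have hht := ht_lt hlt
  obtain ⟨x, hxp, hxq⟩ := Set.not_subset.1 (fun hh : p ≤ q => hne (le_antisymm hqp hh))
  obtain ⟨g, hg, hk⟩ := dev_killG (q ⊔ Ideal.span {x}) p M (i+1) (fun q' hq' h1 h2 => by
    have h3 := lt_of_sup_le hxq h1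
    have := ht_lt h3
    exact ih q' hq' h3 h2 (i+1) (by omega))
    (QuotSMulTop x (R ⧸ q)) (quotSMul_ann x)
  have hinj : Function.Injective (x • (LinearMap.id : (R ⧸ q) →ₗ[R] (R ⧸ q))) := by
    rw [injective_iff_map_eq_zero]
    intro m hm
    exact regular_quot hxq m hm
  have hex : Function.Exact (x • (LinearMap.id : (R ⧸ q) →ₗ[R] (R ⧸ q)))
      (Submodule.mkQ (x • (⊤ : Submodule R (R ⧸ q)))) := by
    rw [LinearMap.exact_iff, Submodule.ker_mkQ]
    ext y
    simp [Submodule.mem_smul_pointwise_iff_exists, LinearMap.mem_range]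
  obtain ⟨d, h1, h2⟩ := (les' M hinj hex (Submodule.mkQ_surjective _)).2 i
  obtain ⟨g', hg', H⟩ := nakayama (E := EX R (R ⧸ q) M i) hxp hg (fun e => by
    obtain ⟨e', he'⟩ := (h1 (g • e)).1 (by rw [map_smul]; exact hk _)
    exact ⟨e', by rw [← he', gmap_smul_id]⟩)
  exact ⟨g', hg', H⟩

theorem exists_regular_elt (p : Ideal R) [hp : p.IsPrime]
    (M : Type) [AddCommGroup M] [Module R M] [Module.Finite R M]
    (hM : ∃ g ∉ p, kills (R ⧸ p) M 0 g) :
    ∃ x ∈ p, ∃ g ∉ p, ∀ m : M, x • m = 0 → g • m = 0 := by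
  obtain ⟨g, hg, hk⟩ := hM
  have hass : p ∉ associatedPrimes R M := by
    intro hh
    obtain ⟨-, m, hm⟩ := isAssociatedPrime_iff.1 hh
    have hm : ∀ r, r ∈ p ↔ r • m = 0 :=
      fun r => by rw [hm, Submodule.mem_colon_singleton, Submodule.mem_bot]
    let f : (R ⧸ p) →ₗ[R] M := Submodule.liftQ p (LinearMap.toSpanSingleton R M m) (by
      intro r hr; exact (hm r).1 hr)
    have h1 := hk (Ext.mk₀ (ModuleCat.ofHom f))
    rw [← Ext.mk₀_smul, ← Ext.mk₀_zero] at h1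
    have h2 := (Ext.linearEquiv₀ (R := R)).symm.injective h1
    have h3 := congrArg (fun φ => φ.hom (Submodule.Quotient.mk (1:R) : R ⧸ p)) h2
    apply hg
    rw [hm]
    have h4 : f (Submodule.Quotient.mk (1:R)) = m := by
      change (LinearMap.toSpanSingleton R M m) 1 = m
      simp
    change g • f (Submodule.Quotient.mk (1:R)) = 0 at h3
    rwa [h4] at h3
  have hfin : {q ∈ associatedPrimes R M | q ≤ p}.Finite :=
    (associatedPrimes.finite R M).subset (fun q hq => hq.1)
  have hav : ¬ ((p : Set R) ⊆ ⋃ q ∈ {q ∈ associatedPrimes R M | q ≤ p}, (q : Set R)) := by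
    intro hh
    obtain ⟨q, hq, hle⟩ := (Ideal.subset_union_prime_finite hfin (f := id) 0 0
      (fun q hq _ _ => hq.1.isPrime)).1 hh
    exact hass (by rw [le_antisymm hle hq.2]; exact hq.1)
  obtain ⟨x, hxp, hx⟩ := Set.not_subset.1 hav
  refine ⟨x, hxp, ?_⟩
  by_contra! hcon
  let N : Submodule R M := LinearMap.ker (x • (LinearMap.id : M →ₗ[R] M))
  have hN : Module.annihilator R N ≤ p := by
    intro r hr
    by_contra hrp
    obtain ⟨m, hm, hm'⟩ := hcon r hrp
    have := Module.mem_annihilator.1 hr ⟨m, hm⟩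
    exact hm' (congrArg Subtype.val this)
  obtain ⟨q0, hq0, hle⟩ := exists_minimal_le hN
  obtain ⟨m, hm⟩ := assoc_of_minimal hq0
  apply hx
  simp only [Set.mem_iUnion]
  refine ⟨q0, ⟨isAssociatedPrime_iff.2 ⟨hq0.isPrime, m.1, ?_⟩, hle⟩, ?_⟩
  · ext r
    rw [hm r, Submodule.mem_colon_singleton, Submodule.mem_bot, Subtype.ext_iff]
    rfl
  · rw [SetLike.mem_coe, hm, Subtype.ext_iff]
    exact m.2

theorem mainKill (h : CMH R) (d : ℕ) : ∀ (M : Type) [AddCommGroup M] [Module R M]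
    [Module.Finite R M] (p : Ideal R) [p.IsPrime] (t : ℕ), ht p ≤ t + d → ExtAt p d M →
    ∃ a ∉ p, Kill t M a := by
  induction d using Nat.strong_induction_on with
  | _ d ih =>
  intro M _ _ _ p hp t htd hE
  rcases d with _ | d
  · obtain ⟨a, ha, hk⟩ := lemmaE0 h p M
    exact ⟨a, ha, hk.mono htd⟩
  by_contra! hcon
  have hK : killIdeal t M ≤ p := by
    intro a ha
    by_contra hap
    exact hcon a hap ha
  obtain ⟨p', hp', hle⟩ := exists_minimal_le hK
  have hpp : p'.IsPrime := hp'.isPrime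
  have hE' : ExtAt p' (d + 1 - (ht p - ht p')) M := by
    intro i hi
    obtain ⟨g, hg, hk⟩ := ischebeck p (d+1) M hE p' hpp hle i (by omega)
    exact ⟨g, fun hh => hg (hle hh), hk⟩
  have hhle := ht_le hle
  by_cases hlt : d + 1 - (ht p - ht p') < d + 1
  · obtain ⟨a, ha, hk⟩ := ih _ hlt M p' t (by omega) hE'
    exact ha (hp'.1.2 hk)
  rw [show d + 1 - (ht p - ht p') = d + 1 by omega] at hE'
  obtain ⟨x, hx, g1, hg1, hgx⟩ := exists_regular_elt p' M (hE' 0 (by omega))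
  have hEx : ExtAt p' d (QuotSMulTop x M) := by
    intro i hi
    obtain ⟨b, hb, hkb⟩ := hE' i (by omega)
    obtain ⟨c, hc, hkc⟩ := hE' (i+1) (by omega)
    exact ⟨_, mul_nmem (mul_nmem hb hc) hg1, kills_Q hgx hkb hkc⟩
  obtain ⟨a, ha, hka⟩ := ih d (by omega) (QuotSMulTop x M) p' (t+1) (by omega) hEx
  obtain ⟨g, hg, k, hk⟩ := exists_pow_of_minimal hp' hx
  have := Kill_of_quot hgx hka hk
  exact mul_nmem (pow_nmem (mul_nmem ha hg1) k) hg (hp'.1.2 this)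

end
end S13


namespace S13
section
variable {R : Type} [CommRing R] [IsNoetherianRing R]

theorem exists_common (p : Ideal R) [hp : p.IsPrime]
    (M : Type) [AddCommGroup M] [Module R M] [Module.Finite R M] (x : R)
    (h : ∀ m : M, x • m = 0 → ∃ c ∉ p, c • m = 0) : ∃ g ∉ p, ∀ m : M, x • m = 0 → g • m = 0 := by
  by_contra! hcon
  let N : Submodule R M := LinearMap.ker (x • (LinearMap.id : M →ₗ[R] M))
  have hN : Module.annihilator R N ≤ p := by
    intro r hr
    by_contra hrp
    obtain ⟨m, hm, hm'⟩ := hcon r hrp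
    have := Module.mem_annihilator.1 hr ⟨m, hm⟩
    exact hm' (congrArg Subtype.val this)
  obtain ⟨q0, hq0, hle⟩ := exists_minimal_le hN
  obtain ⟨m, hm⟩ := assoc_of_minimal hq0
  obtain ⟨c, hc, hcm⟩ := h m.1 m.2
  exact hc (hle ((hm c).2 (Subtype.ext hcm)))

open Pointwise in
theorem localized_smul (p : Ideal R) [hp : p.IsPrime]
    {M M' : Type} [AddCommGroup M] [Module R M] [AddCommGroup M'] [Module R M']
    [Module (Localization.AtPrime p) M'] [IsScalarTower R (Localization.AtPrime p) M']
    (f : M →ₗ[R] M') [IsLocalizedModule p.primeCompl f] (u : R) (v : p.primeCompl) :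
    (u • (⊤ : Submodule R M)).localized' (Localization.AtPrime p) p.primeCompl f =
      (IsLocalization.mk' (Localization.AtPrime p) u v) • (⊤ : Submodule _ M') := by
  ext y
  rw [Submodule.mem_localized', Submodule.mem_smul_pointwise_iff_exists]
  constructor
  · rintro ⟨m, hm, s, rfl⟩
    obtain ⟨m0, -, rfl⟩ := (Submodule.mem_smul_pointwise_iff_exists _ _ _).1 hm
    refine ⟨IsLocalizedModule.mk' f (v • m0) s, trivial, ?_⟩
    rw [IsLocalizedModule.mk'_smul_mk', smul_comm, IsLocalizedModule.mk'_cancel_left]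
  · rintro ⟨z, -, rfl⟩
    obtain ⟨⟨m, s⟩, rfl⟩ := IsLocalizedModule.mk'_surjective p.primeCompl f z
    refine ⟨u • m, Submodule.smul_mem_pointwise_smul _ _ _ trivial, v * s, ?_⟩
    simp [Function.uncurry, IsLocalizedModule.mk'_smul_mk']

open Pointwise in
theorem SeqAt_of_regular (p : Ideal R) [hp : p.IsPrime] (rs : List (Localization.AtPrime p)) :
    ∀ (M M' : Type) [AddCommGroup M] [Module R M] [Module.Finite R M] [AddCommGroup M']
    [Module R M'] [Module (Localization.AtPrime p) M'] [IsScalarTower R (Localization.AtPrime p) M']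
    (f : M →ₗ[R] M') [IsLocalizedModule p.primeCompl f],
    (∀ r ∈ rs, r ∈ IsLocalRing.maximalIdeal (Localization.AtPrime p)) →
    RingTheory.Sequence.IsWeaklyRegular M' rs → SeqAt p rs.length M := by
  induction rs with
  | nil => intros; trivial
  | cons r rs ih =>
    intro M M' _ _ _ _ _ _ _ f _ hmem hreg
    rw [RingTheory.Sequence.isWeaklyRegular_cons_iff] at hreg
    obtain ⟨u, v, rfl⟩ := IsLocalization.exists_mk'_eq p.primeCompl r
    have hu : u ∈ p := (IsLocalization.AtPrime.mk'_mem_maximal_iff _ p u v).1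
      (hmem _ List.mem_cons_self)
    refine ⟨u, hu, exists_common p M u ?_, ?_⟩
    · intro m hm
      have h0 : f m = 0 := by
        have h1 : IsLocalization.mk' (Localization.AtPrime p) u v • f m = 0 := by
          rw [← IsLocalizedModule.mk'_one p.primeCompl, IsLocalizedModule.mk'_smul_mk', hm,
            IsLocalizedModule.mk'_zero]
        apply hreg.1
        simpa using h1
      obtain ⟨c, hc⟩ := (IsLocalizedModule.eq_zero_iff p.primeCompl f).1 h0
      exact ⟨c.1, c.2, hc⟩
    · refine ih (QuotSMulTop u M)
        (M' ⧸ (u • (⊤ : Submodule R M)).localized' (Localization.AtPrime p) p.primeCompl f)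
        (Submodule.toLocalizedQuotient' (Localization.AtPrime p) p.primeCompl f
          (u • (⊤ : Submodule R M)))
        (fun r hr => hmem r (List.mem_cons_of_mem _ hr)) ?_
      exact ((Submodule.quotEquivOfEq _ _ (localized_smul p f u v)).isWeaklyRegular_congr rs).2
        hreg.2

theorem seqDepth_attained {A : Type} [CommRing A] (I : Ideal A) (M : Type) [AddCommGroup M]
    [Module A M] (n : ℕ) (h : seqDepth I M = n) :
    ∃ rs : List A, (∀ r ∈ rs, r ∈ I) ∧ RingTheory.Sequence.IsWeaklyRegular M rs ∧
      rs.length = n := by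
  unfold seqDepth at h
  have hne : {n : ℕ∞ | ∃ rs : List A, (∀ r ∈ rs, r ∈ I) ∧
    RingTheory.Sequence.IsWeaklyRegular M rs ∧ rs.length = n}.Nonempty :=
    ⟨0, [], by simp, RingTheory.Sequence.IsWeaklyRegular.nil _ _, by simp⟩
  have := hne.to_subtype
  have := ENat.sSup_mem_of_nonempty_of_lt_top (by rw [h]; exact ENat.natCast_lt_top n)
  rw [h] at this
  obtain ⟨rs, h1, h2, h3⟩ := this
  exact ⟨rs, h1, h2, by exact_mod_cast h3⟩

theorem ringDepth_eq (hCM : IsCohenMacaulayRing R) (p : Ideal R) [hp : p.IsPrime] :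
    ringDepthAt R p = ht p := by
  have h := hCM p hp
  rw [IsLocalization.AtPrime.ringKrullDim_eq_height p, ← coe_ht] at h
  exact_mod_cast h

theorem CMH_of (hCM : IsCohenMacaulayRing R) : CMH R := by
  intro p hp
  obtain ⟨rs, h1, h2, h3⟩ := seqDepth_attained _ _ _ (ringDepth_eq hCM p)
  have := SeqAt_of_regular p rs R (Localization.AtPrime p) (Algebra.linearMap _ _) h1 h2
  rwa [h3] at this

theorem exists_kill (hCM : IsCohenMacaulayRing R) (p : Ideal R) [hp : p.IsPrime]
    (M : Type) [AddCommGroup M] [Module R M] [Module.Finite R M]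
    (t : ℕ) (htt : (t : ℕ∞) + moduleDepthAt p M = ringDepthAt R p) : ∃ s ∉ p, Kill t M s := by
  rw [ringDepth_eq hCM] at htt
  have hfin : moduleDepthAt p M ≠ ⊤ := by
    intro hh; rw [hh, add_top] at htt; exact ENat.natCast_ne_top _ htt.symm
  obtain ⟨d, hd⟩ := ENat.ne_top_iff_exists.1 hfin
  rw [← hd] at htt
  have htd : t + d = ht p := by exact_mod_cast htt
  obtain ⟨rs, h1, h2, h3⟩ := seqDepth_attained _ _ d hd.symm
  have hs := SeqAt_of_regular p rs M (LocalizedModule p.primeCompl M)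
    (LocalizedModule.mkLinearMap _ _) h1 h2
  rw [h3] at hs
  exact mainKill (CMH_of hCM) d M p t htd.ge (ExtAt_of_SeqAt p d M hs)

end
end S13


namespace S13
section
variable {R : Type} [CommRing R] [IsNoetherianRing R]

theorem homology_kill (K : CochainComplex (ModuleCat.{0} R) ℕ) (n : ℕ) (s : R)
    (h : ∀ f : K.X n, K.d n (n+1) f = 0 →
      s • f = 0 ∨ ∃ p, ∃ g : K.X p, K.d p n g = s • f)
    (x : K.homology n) : s • x = 0 := by
  have hsurj : Function.Surjective (K.homologyπ n) :=
    (ModuleCat.epi_iff_surjective _).1 inferInstance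
  have hinj : Function.Injective (K.iCycles n) :=
    (ModuleCat.mono_iff_injective _).1 inferInstance
  obtain ⟨z, rfl⟩ := hsurj x
  have hz : K.d n (n+1) (K.iCycles n z) = 0 := by
    rw [← ModuleCat.comp_apply, HomologicalComplex.iCycles_d]; rfl
  rcases h _ hz with h0 | ⟨p, g, hg⟩
  · have : s • z = 0 := hinj (by rw [map_smul, h0, map_zero])
    rw [← map_smul, this, map_zero]
  · have : s • z = K.toCycles p n g := hinj (by
      rw [map_smul, ← hg, ← ModuleCat.comp_apply, HomologicalComplex.toCycles_i])
    rw [← map_smul, this, ← ModuleCat.comp_apply, HomologicalComplex.toCycles_comp_homologyπ]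
    rfl

theorem smul_zero_aux {A B C : ModuleCat.{0} R} (π : A ⟶ B) (g : B ⟶ C) (f : A ⟶ C) (s : R)
    (hg : π ≫ g = f) (h : s • g = 0) : s • f = 0 := by
  rw [← hg, ← Linear.comp_smul, h, Limits.comp_zero]

theorem extOld_kill (G M : ModuleCat.{0} R) (n : ℕ) (s : R)
    (h : ∀ e : CategoryTheory.Abelian.Ext G M n, s • e = 0)
    (x : ((_root_.Ext R (ModuleCat.{0} R) n).obj (Opposite.op G)).obj M) : s • x = 0 := by
  let P := projectiveResolution G
  have key : ∀ y : (P.complex.linearYonedaObj R M).homology n, s • y = 0 := by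
    apply homology_kill
    intro f hf
    change P.complex.X n ⟶ M at f
    change P.complex.d (n+1) n ≫ f = 0 at hf
    have h1 : P.extMk (f ≫ (s • 𝟙 M)) (n+1) rfl (by rw [reassoc_of% hf]; simp) = 0 := by
      rw [← P.extMk_comp_mk₀ f (n+1) rfl hf, ← Ext.smul_eq_comp_mk₀]
      exact h _
    have hfs : f ≫ (s • 𝟙 M) = s • f := by simp
    cases n with
    | zero =>
      left
      let g : G ⟶ M := P.exact₀.desc f hf
      have hg : P.π.f 0 ≫ g = f := P.exact₀.g_desc f hf
      have h2 := h (Ext.mk₀ g)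
      rw [← Ext.mk₀_smul] at h2
      have h3 : s • g = 0 := (Ext.mk₀_bijective _ _).1 (by rw [h2, Ext.mk₀_zero])
      change s • f = 0
      exact smul_zero_aux (P.π.f 0) g f s hg h3
    | succ p =>
      right
      obtain ⟨g, hg⟩ := (P.extMk_eq_zero_iff _ _ _ _ p rfl).1 h1
      exact ⟨p, g, hg.trans hfs⟩
  let φ := (P.isoExt (R := R) n M)
  have hx : φ.inv (φ.hom x) = x := by
    rw [← ModuleCat.comp_apply, φ.hom_inv_id]; rfl
  rw [← hx, ← map_smul, key, map_zero]

open Limits in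
theorem lc_kill (a : Ideal R) (M : ModuleCat.{0} R) (i : ℕ) (s : R)
    (h : ∀ k : ℕ, ∀ e : CategoryTheory.Abelian.Ext (ModuleCat.of R (R ⧸ a ^ k)) M i, s • e = 0)
    (x : (localCohomology a i).obj M) : s • x = 0 := by
  let F := localCohomology.diagram (localCohomology.idealPowersDiagram a) i
  have hc := isColimitOfPreserves ((evaluation _ _).obj M) (colimit.isColimit F)
  have : s • 𝟙 ((localCohomology a i).obj M) = 0 := by
    refine hc.hom_ext fun j => ?_
    ext y
    change (s • 𝟙 ((localCohomology a i).obj M)) ((colimit.ι F j).app M y) = 0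
    have hy : s • y = 0 := extOld_kill _ _ i s (h _) y
    change s • ((colimit.ι F j).app M y) = 0
    rw [← map_smul, hy, map_zero]
  have := congrArg (fun f => f.hom x) this
  exact this

theorem ext_vanish (a : Ideal R) (rs : List R) (hmem : ∀ r ∈ rs, r ∈ a)
    (hreg : RingTheory.Sequence.IsWeaklyRegular R rs) (k : ℕ) :
    ∀ j < rs.length, Subsingleton (EX R (R ⧸ a ^ k) R j) := by
  by_cases ha : a ^ k = ⊤
  · intro j _
    have : Subsingleton (R ⧸ a ^ k) := Ideal.Quotient.subsingleton_iff.2 ha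
    have hz : Limits.IsZero (ModuleCat.of R (R ⧸ a ^ k)) := ModuleCat.isZero_of_subsingleton _
    refine ⟨fun x y => ?_⟩
    rw [← Ext.mk₀_id_comp x, ← Ext.mk₀_id_comp y, (Limits.IsZero.iff_id_eq_zero _).1 hz]
    simp
  have hk : a ≠ ⊤ := by
    rintro rfl; exact ha (Ideal.top_pow _ _)
  refine ModuleCat.subsingleton_ext_of_exists_isRegular a (ModuleCat.of R (R ⧸ a ^ k)) ?_
    (ModuleCat.of R R) ?_ rs hmem ⟨hreg, ?_⟩
  · change Module.support R (R ⧸ a ^ k) ⊆ _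
    rw [Module.support_eq_zeroLocus, Ideal.annihilator_quotient,
      PrimeSpectrum.zeroLocus_subset_zeroLocus_iff]
    intro x hx
    exact ⟨k, Ideal.pow_mem_pow hx k⟩
  · change a • (⊤ : Ideal R) < ⊤
    rw [smul_eq_mul, Ideal.mul_top]
    exact lt_top_iff_ne_top.2 hk
  · change (⊤ : Ideal R) ≠ Ideal.ofList rs • (⊤ : Ideal R)
    rw [smul_eq_mul, Ideal.mul_top]
    intro h
    exact hk (top_le_iff.1 (h.le.trans (Ideal.span_le.2 hmem)))

end
end S13

theorem stmt13 {R : Type} [CommRing R] [IsNoetherianRing R] (hCM : IsCohenMacaulayRing R)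
    (p : Ideal R) [p.IsPrime]
    (M : Type) [AddCommGroup M] [Module R M] [Module.Finite R M]
    (hnz : Nontrivial (LocalizedModule p.primeCompl M))
    (t : ℕ) (ht : (t : ℕ∞) + moduleDepthAt p M = ringDepthAt R p) :
    ∃ s ∉ p, ∀ (a : Ideal R) (i : ℕ), (i : ℕ∞) + t < a.grade →
      ∀ x : ((localCohomology a i).obj (ModuleCat.of R M)), s • x = 0 := by
  obtain ⟨s, hs, hK⟩ := S13.exists_kill hCM p M t ht
  refine ⟨s, hs, fun a i hlt x => ?_⟩
  unfold Ideal.grade seqDepth at hlt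
  obtain ⟨_, ⟨rs, hmem, hreg, rfl⟩, hlen⟩ := lt_sSup_iff.1 hlt
  have hlen' : i + t < rs.length := by exact_mod_cast hlen
  exact S13.lc_kill a _ i s (fun k => hK i _ rs.length (S13.ext_vanish a rs hmem hreg k) hlen') x
end

section
/- Let R be a Cohen-Macaulay commutative Noetherian ring, p a prime ideal, M a finitely generated R-module with M_p ≠ 0, and t ≥ 0 an integer. Suppose there exists s ∈ R \ p such that s·H^i_a(M) = 0 for all ideals a of R and all integers i < grade(a,R) − t. Then t ≥ depth R_p − depth M_p. -/
namespace S14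
open CategoryTheory Limits Opposite
section cmp
variable {R : Type} [CommRing R]
abbrev F (M : ModuleCat.{0} R) : ModuleCat.{0} R ⥤ (ModuleCat.{0} R)ᵒᵖ :=
  ((linearYoneda R (ModuleCat.{0} R)).obj M).rightOp

abbrev K (M : ModuleCat.{0} R) {N : ModuleCat.{0} R} (P : ProjectiveResolution N) :
    ChainComplex (ModuleCat.{0} R)ᵒᵖ ℕ := ((F M).mapHomologicalComplex _).obj P.complex

def Rep (M : ModuleCat.{0} R) {N : ModuleCat.{0} R} (P : ProjectiveResolution N) (d : ℕ)
   (f : P.complex.X d ⟶ M) (x : ((Ext R (ModuleCat.{0} R) d).obj (op N)).obj M) : Prop :=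
  ∃ z : ((K M P).opcycles d).unop, ((K M P).pOpcycles d).unop.hom z = f ∧
    ((K M P).homologyι d).unop.hom z = (P.isoLeftDerivedObj (F M) d).inv.unop.hom x

lemma exact_op_elem (S : ShortComplex (ModuleCat.{0} R)ᵒᵖ) (hS : S.Exact)
    (x : S.X₂.unop) (hx : S.f.unop.hom x = 0) : ∃ y : S.X₃.unop, S.g.unop.hom y = x := by
  exact (ShortComplex.moduleCat_exact_iff _).1 hS.unop x hx

lemma Rep.exists (M : ModuleCat.{0} R) {N : ModuleCat.{0} R} (P : ProjectiveResolution N) (d : ℕ)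
   (f : P.complex.X d ⟶ M) (hf : P.complex.d (d+1) d ≫ f = 0) : ∃ x, Rep M P d f x := by
  have h1 := (K M P).d_pOpcycles (d+1) d
  have h2 : (ShortComplex.mk _ _ h1).Exact :=
    ShortComplex.exact_of_g_is_cokernel _ ((K M P).opcyclesIsCokernel (d+1) d (by simp))
  obtain ⟨z, hz⟩ := exact_op_elem _ h2 f hf
  refine ⟨(P.isoLeftDerivedObj (F M) d).hom.unop.hom (((K M P).homologyι d).unop.hom z), z, hz, ?_⟩
  have := congrArg (fun u => u.unop.hom (((K M P).homologyι d).unop.hom z)) (P.isoLeftDerivedObj (F M) d).inv_hom_id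
  exact this.symm

lemma Rep.smul {M : ModuleCat.{0} R} {N : ModuleCat.{0} R} {P : ProjectiveResolution N} {d : ℕ}
   {f : P.complex.X d ⟶ M} {x} (h : Rep M P d f x) (s : R) : Rep M P d (s • f) (s • x) := by
  obtain ⟨z, hz, hz'⟩ := h
  refine ⟨s • z, ?_, ?_⟩
  · rw [map_smul, hz]; rfl
  · rw [map_smul, hz']; exact (map_smul _ _ _).symm

lemma Rep.map {M : ModuleCat.{0} R} {N N' : ModuleCat.{0} R} {P : ProjectiveResolution N}
   {P' : ProjectiveResolution N'} (g : N' ⟶ N) (φ : P'.complex ⟶ P.complex)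
   (comm : φ.f 0 ≫ P.π.f 0 = P'.π.f 0 ≫ g) {d : ℕ}
   {f : P.complex.X d ⟶ M} {x} (h : Rep M P d f x) :
   Rep M P' d (φ.f d ≫ f) (((Ext R (ModuleCat.{0} R) d).map g.op).app M x) := by
  obtain ⟨z, hz, hz'⟩ := h
  let Φ : K M P' ⟶ K M P := ((F M).mapHomologicalComplex _).map φ
  refine ⟨(HomologicalComplex.opcyclesMap Φ d).unop.hom z, ?_, ?_⟩
  · have := congrArg (fun u => u.unop.hom z) (HomologicalComplex.p_opcyclesMap Φ d)
    refine this.trans ?_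
    change (Φ.f d).unop.hom (((K M P).pOpcycles d).unop.hom z) = _
    rw [hz]; rfl
  · have := congrArg (fun u => u.unop.hom z) (HomologicalComplex.homologyι_naturality Φ d)
    refine this.symm.trans ?_
    change (HomologicalComplex.homologyMap Φ d).unop.hom (((K M P).homologyι d).unop.hom z) = _
    rw [hz']
    have := congrArg (fun u => u.unop.hom x) (ProjectiveResolution.isoLeftDerivedObj_inv_naturality g P' P φ comm (F M) d)
    exact this.symm

lemma Rep.zero {M : ModuleCat.{0} R} {N : ModuleCat.{0} R} {P : ProjectiveResolution N} {d : ℕ}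
   {f : P.complex.X d ⟶ M} (h : Rep M P d f 0) :
   ∃ g, P.complex.d d ((ComplexShape.down ℕ).next d) ≫ g = f := by
  obtain ⟨z, hz, hz'⟩ := h
  replace hz' := hz'.trans (map_zero (P.isoLeftDerivedObj (F M) d).inv.unop.hom)
  have h1 := (K M P).homologyι_comp_fromOpcycles d ((ComplexShape.down ℕ).next d)
  have h2 : (ShortComplex.mk _ _ h1).Exact :=
    ShortComplex.exact_of_f_is_kernel _ ((K M P).homologyIsKernel d _ rfl)
  obtain ⟨g, hg⟩ := exact_op_elem _ h2 z hz'
  refine ⟨g, ?_⟩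
  rw [← hz, ← hg]
  have := congrArg (fun u => u.unop.hom g) ((K M P).p_fromOpcycles d ((ComplexShape.down ℕ).next d))
  exact this.symm

open Abelian in
lemma extMk_zero_of {M : ModuleCat.{0} R} {N : ModuleCat.{0} R} {P : ProjectiveResolution N} {d : ℕ}
   {f : P.complex.X d ⟶ M} (h : Rep M P d f 0) (hf : P.complex.d (d+1) d ≫ f = 0) :
   P.extMk f (d+1) rfl hf = 0 := by
  obtain ⟨g, rfl⟩ := h.zero
  cases d with
  | zero => 
    simp
  | succ n =>
    have e : (ComplexShape.down ℕ).next (n+1) = n := by simp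
    rw [P.extMk_eq_zero_iff _ _ _ _ n rfl]
    generalize (ComplexShape.down ℕ).next (n+1) = m at *
    subst e
    exact ⟨g, rfl⟩

lemma smul_extMk {M : ModuleCat.{0} R} {N : ModuleCat.{0} R} (P : ProjectiveResolution N) {d : ℕ}
   (f : P.complex.X d ⟶ M)  (hf : P.complex.d (d+1) d ≫ f = 0) (s : R) :
   s • P.extMk f (d+1) rfl hf = P.extMk (s • f) (d+1) rfl (by simp [hf]) := by
  rw [Abelian.Ext.smul_eq_comp_mk₀, P.extMk_comp_mk₀]
  congr 1

/-- Key comparison. -/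
lemma cmp (M : ModuleCat.{0} R) (p : Ideal R) (d : ℕ) (s : R)
    (h : ∀ x : ((localCohomology p d).obj M), s • x = 0)
    (e : Abelian.Ext ((localCohomology.ringModIdeals (localCohomology.idealPowersDiagram p)).obj (op 1)) M d) :
    ∃ (k : ℕ) (hk : 1 ≤ k), (Abelian.Ext.mk₀ ((localCohomology.ringModIdeals (localCohomology.idealPowersDiagram p)).map (homOfLE hk).op)).comp (s • e) (zero_add _) = 0 := by
  let P := fun k : ℕ => projectiveResolution ((localCohomology.ringModIdeals (localCohomology.idealPowersDiagram p)).obj (op k))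
  obtain ⟨f, hf, rfl⟩ := (P 1).extMk_surjective e (d+1) rfl
  obtain ⟨x, hx⟩ := Rep.exists M (P 1) d f hf
  let D := localCohomology.diagram (localCohomology.idealPowersDiagram p) d
  have hD : IsColimit (((evaluation _ _).obj M).mapCocone (colimit.cocone D)) := isColimitOfPreserves _ (colimit.isColimit D)
  have h0 := h ((((evaluation _ _).obj M).mapCocone (colimit.cocone D)).ι.app (op (op 1)) x)
  obtain ⟨k, u, v, huv⟩ := Concrete.isColimit_exists_of_rep_eq (D ⋙ (evaluation _ _).obj M) hD (i := op (op 1)) (j := op (op 1)) (s • x) 0 (by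
    rw [map_zero]; exact (map_smul _ _ _).trans h0)
  have hk : 1 ≤ k.unop.unop := leOfHom u.unop.unop
  refine ⟨k.unop.unop, hk, ?_⟩
  let g := ((localCohomology.ringModIdeals (localCohomology.idealPowersDiagram p)).map (homOfLE hk).op)
  let φ := ProjectiveResolution.lift g (P k.unop.unop) (P 1)
  have comm : φ.f 0 ≫ (P 1).π.f 0 = (P k.unop.unop).π.f 0 ≫ g := by
    simpa using ProjectiveResolution.lift_commutes_zero g (P k.unop.unop) (P 1)
  have hr := (hx.smul s).map g φ comm
  have h3 : ((Ext R (ModuleCat.{0} R) d).map g.op).app M (s • x) = 0 := by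
    have h4 : (D ⋙ (evaluation _ _).obj M).map v (0 : ((D ⋙ (evaluation _ _).obj M).obj (op (op 1)))) = 0 := map_zero ((D ⋙ (evaluation _ _).obj M).map v).hom
    exact huv.trans h4
  rw [h3] at hr
  rw [smul_extMk]
  rw [ProjectiveResolution.mk₀_comp_extMk (R := P 1) (R' := P k.unop.unop) (φ := ⟨φ, by simpa using comm⟩)]
  exact extMk_zero_of hr _
end cmp


section lz
open Abelian
variable {R : Type} [CommRing R]

/-- Every class in `Ext^i(N, M)` is killed by some element outside `p`. -/
def LZ (p : Ideal R) (N M : ModuleCat.{0} R) (i : ℕ) : Prop :=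
  ∀ e : Abelian.Ext N M i, ∃ s, s ∉ p ∧ s • e = 0

lemma smul_id_zero {N : ModuleCat.{0} R} {s : R} (hs : ∀ n : N, s • n = 0) :
    s • 𝟙 N = 0 := by
  ext n
  exact hs n

lemma LZ.of_left {p : Ideal R} {N M : ModuleCat.{0} R} {i : ℕ} {s : R} (hs : s ∉ p)
    (h : ∀ n : N, s • n = 0) : LZ p N M i := by
  intro e
  refine ⟨s, hs, ?_⟩
  have : s • e = (Abelian.Ext.mk₀ (s • 𝟙 N)).comp e (zero_add i) := by simp [Abelian.Ext.mk₀_smul]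
  rw [this, smul_id_zero h]; simp

lemma LZ.of_right {p : Ideal R} {N M : ModuleCat.{0} R} {i : ℕ} {s : R} (hs : s ∉ p)
    (h : ∀ n : M, s • n = 0) : LZ p N M i := by
  intro e
  refine ⟨s, hs, ?_⟩
  rw [Abelian.Ext.smul_eq_comp_mk₀, smul_id_zero h]; simp

lemma LZ.mid {p : Ideal R} [hp : p.IsPrime] {S : ShortComplex (ModuleCat.{0} R)} (hS : S.ShortExact)
    {M : ModuleCat.{0} R} {i : ℕ} (h1 : LZ p S.X₁ M i) (h3 : LZ p S.X₃ M i) : LZ p S.X₂ M i := by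
  intro e
  obtain ⟨s, hs, hse⟩ := h1 ((Abelian.Ext.mk₀ S.f).comp e (zero_add i))
  obtain ⟨x, hx⟩ := Abelian.Ext.contravariant_sequence_exact₂ hS M (s • e) (by simpa using hse)
  obtain ⟨t, ht, htx⟩ := h3 x
  refine ⟨t * s, fun hm => (hp.mem_or_mem hm).elim ht hs, ?_⟩
  rw [mul_smul, ← hx, ← Abelian.Ext.comp_smul, htx, Abelian.Ext.comp_zero]

lemma LZ.coker {p : Ideal R} [hp : p.IsPrime] {S : ShortComplex (ModuleCat.{0} R)} (hS : S.ShortExact)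
    {N : ModuleCat.{0} R} {i : ℕ} (h2 : LZ p N S.X₂ i) (h1 : LZ p N S.X₁ (i+1)) : LZ p N S.X₃ i := by
  intro e
  obtain ⟨s, hs, hse⟩ := h1 (e.comp hS.extClass rfl)
  obtain ⟨x, hx⟩ := Abelian.Ext.covariant_sequence_exact₃ N hS (s • e) rfl (by simpa using hse)
  obtain ⟨t, ht, htx⟩ := h2 x
  refine ⟨t * s, fun hm => (hp.mem_or_mem hm).elim ht hs, ?_⟩
  rw [mul_smul, ← hx, ← Abelian.Ext.smul_comp, htx, Abelian.Ext.zero_comp]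

lemma LZ.iso {p : Ideal R} {N N' M : ModuleCat.{0} R} {i : ℕ} (h : LZ p N M i)
    (g : N ≅ N') : LZ p N' M i := by
  intro e
  obtain ⟨s, hs, hse⟩ := h ((Abelian.Ext.mk₀ g.hom).comp e (zero_add i))
  refine ⟨s, hs, ?_⟩
  rw [← Abelian.Ext.comp_smul] at hse
  have := congrArg (fun y => (Abelian.Ext.mk₀ g.inv).comp y (zero_add i)) hse
  simpa using this

lemma devissage [IsNoetherianRing R] {p : Ideal R} [hp : p.IsPrime] {M : ModuleCat.{0} R} {i : ℕ}
    (h : LZ p (ModuleCat.of R (R ⧸ p)) M i) (N : Type) [AddCommGroup N] [Module R N]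
    [hN : Module.Finite R N] (hr : ∀ x ∈ p, ∃ k : ℕ, ∀ n : N, x ^ k • n = 0) :
    LZ p (ModuleCat.of R N) M i := by
  induction hN using IsNoetherianRing.induction_on_isQuotientEquivQuotientPrime R with
  | subsingleton N =>
    exact LZ.of_left (s := 1) ((Ideal.ne_top_iff_one p).1 hp.ne_top)
      (fun n => Subsingleton.elim (α := N) _ _)
  | quotient N q e =>
    have hpq : p ≤ q.1 := by
      intro x hx
      obtain ⟨k, hk⟩ := hr x hx
      have h1 := hk (e.symm (Ideal.Quotient.mk _ 1))
      have h2 := congrArg e h1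
      rw [map_smul, e.apply_symm_apply, map_zero, ← Ideal.Quotient.mk_eq_mk, ← Submodule.Quotient.mk_smul,
        Submodule.Quotient.mk_eq_zero] at h2
      exact q.2.mem_of_pow_mem k (by simpa using h2)
    by_cases hq : q.1 ≤ p
    · have : q.1 = p := le_antisymm hq hpq
      have e' : N ≃ₗ[R] R ⧸ p := e.trans (Submodule.quotEquivOfEq _ _ this)
      exact h.iso e'.symm.toModuleIso
    · obtain ⟨s, hs, hsp⟩ := Set.not_subset.1 hq
      refine LZ.of_left hsp (fun n => ?_)
      apply e.injective
      change e (s • n) = e 0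
      rw [map_smul, map_zero]
      obtain ⟨r, hr⟩ := Ideal.Quotient.mk_surjective (e n)
      rw [← hr, ← Ideal.Quotient.mk_eq_mk, ← Submodule.Quotient.mk_smul, Submodule.Quotient.mk_eq_zero]
      exact Ideal.mul_mem_right _ _ hs
  | exact N₁ N₂ N₃ f g hf hg hfg h₁ h₃ =>
    have hS : (ShortComplex.mk (ModuleCat.ofHom f) (ModuleCat.ofHom g)
        (by ext x; exact hfg.apply_apply_eq_zero x)).ShortExact :=
      { exact := (ShortComplex.ShortExact.moduleCat_exact_iff_function_exact _).2 hfg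
        mono_f := (ModuleCat.mono_iff_injective _).2 hf
        epi_g := (ModuleCat.epi_iff_surjective _).2 hg }
    refine LZ.mid hS (h₁ ?_) (h₃ ?_)
    · intro x hx
      obtain ⟨k, hk⟩ := hr x hx
      exact ⟨k, fun n => hf (by rw [map_smul, hk, map_zero])⟩
    · intro x hx
      obtain ⟨k, hk⟩ := hr x hx
      refine ⟨k, fun n => ?_⟩
      obtain ⟨m, rfl⟩ := hg n
      rw [← map_smul, hk, map_zero]

lemma LZ_step [IsNoetherianRing R] {p : Ideal R} [hp : p.IsPrime] (M : ModuleCat.{0} R) (d : ℕ)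
    (s : R) (hs : s ∉ p) (h : ∀ x : ((localCohomology p d).obj M), s • x = 0)
    (ih : ∀ i < d, LZ p (ModuleCat.of R (R ⧸ p)) M i) : LZ p (ModuleCat.of R (R ⧸ p)) M d := by
  let Q := localCohomology.ringModIdeals (localCohomology.idealPowersDiagram p)
  have e1 : Q.obj (op 1) ≅ ModuleCat.of R (R ⧸ p) :=
    (Submodule.quotEquivOfEq (p ^ 1) p (pow_one p)).toModuleIso
  refine LZ.iso ?_ e1
  intro e
  obtain ⟨k, hk, hke⟩ := cmp M p d s h e
  have hepi : Epi (Q.map (homOfLE hk).op) := by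
    rw [ModuleCat.epi_iff_surjective]
    intro x
    obtain ⟨r, rfl⟩ := Submodule.Quotient.mk_surjective _ x
    exact ⟨Submodule.Quotient.mk r, rfl⟩
  cases d with
  | zero =>
    refine ⟨s, hs, ?_⟩
    apply Abelian.Ext.precomp_mk₀_injective_of_epi M (Q.map (homOfLE hk).op)
    simpa using hke
  | succ d =>
    let g := (Q.map (homOfLE hk).op).hom
    have hS : (ShortComplex.mk (ModuleCat.ofHom (LinearMap.ker g).subtype) (Q.map (homOfLE hk).op)
        (by ext x; exact x.2)).ShortExact :=
      { exact := (ShortComplex.ShortExact.moduleCat_exact_iff_function_exact _).2 (LinearMap.exact_subtype_ker_map g)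
        mono_f := (ModuleCat.mono_iff_injective _).2 (Submodule.injective_subtype _)
        epi_g := hepi }
    obtain ⟨x, hx⟩ := Abelian.Ext.contravariant_sequence_exact₃ hS M (s • e) hke (add_comm 1 d)
    have : IsNoetherian R (Q.obj (op k)) := inferInstanceAs (IsNoetherian R (R ⧸ p ^ k))
    have hker : LZ p (ModuleCat.of R (LinearMap.ker g)) M d := by
      refine devissage (ih d (Nat.lt_succ_self d)) _ (fun y hy => ⟨k, fun n => Subtype.ext ?_⟩)
      obtain ⟨n, hn⟩ := n
      obtain ⟨r, rfl⟩ := Submodule.Quotient.mk_surjective _ n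
      change (Submodule.Quotient.mk (y ^ k • r) : R ⧸ p ^ k) = 0
      rw [Submodule.Quotient.mk_eq_zero]
      exact Ideal.mul_mem_right _ _ (Ideal.pow_mem_pow hy k)
    obtain ⟨t, ht, htx⟩ := hker x
    refine ⟨t * s, fun hm => (hp.mem_or_mem hm).elim ht hs, ?_⟩
    rw [mul_smul, ← hx, ← Abelian.Ext.comp_smul, htx, Abelian.Ext.comp_zero]

lemma LZ_all [IsNoetherianRing R] {p : Ideal R} [hp : p.IsPrime] (M : ModuleCat.{0} R) (d : ℕ)
    (s : R) (hs : s ∉ p) (h : ∀ i < d, ∀ x : ((localCohomology p i).obj M), s • x = 0) :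
    ∀ i < d, LZ p (ModuleCat.of R (R ⧸ p)) M i := by
  intro i
  induction i using Nat.strong_induction_on with
  | _ i ih =>
    intro hi
    exact LZ_step M i s hs (h i hi) (fun j hj => ih j hj (hj.trans hi))
end lz

section regseq
variable {R : Type} [CommRing R]
open RingTheory.Sequence
open scoped Pointwise

lemma isLoc_quot (S : Submonoid R) {M L : Type} [AddCommGroup M] [Module R M] [AddCommGroup L]
    [Module R L] (f : M →ₗ[R] L) [IsLocalizedModule S f] (x : R) (hf : Function.Injective f) :
    IsLocalizedModule S (QuotSMulTop.map x f) where
  map_units s := by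
    have hb := (Module.End.isUnit_iff _).1 (IsLocalizedModule.map_units f s)
    rw [Module.End.isUnit_iff]
    constructor
    · refine (injective_iff_map_eq_zero (algebraMap R (Module.End R (QuotSMulTop x L)) s)).2 fun y hy => ?_
      obtain ⟨l, rfl⟩ := Submodule.Quotient.mk_surjective _ y
      change (Submodule.Quotient.mk ((s : R) • l) : QuotSMulTop x L) = 0 at hy
      rw [Submodule.Quotient.mk_eq_zero, Submodule.mem_smul_pointwise_iff_exists] at hy ⊢
      obtain ⟨l', -, hl'⟩ := hy
      obtain ⟨l'', hl''⟩ := hb.2 l'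
      refine ⟨l'', trivial, hb.1 ?_⟩
      change (s : R) • x • l'' = (s : R) • l
      change (s : R) • l'' = l' at hl''
      rw [smul_comm, hl'', hl']
    · intro y
      obtain ⟨l, rfl⟩ := Submodule.Quotient.mk_surjective _ y
      obtain ⟨l', rfl⟩ := hb.2 l
      exact ⟨Submodule.Quotient.mk l', rfl⟩
  surj y := by
    obtain ⟨l, rfl⟩ := Submodule.Quotient.mk_surjective _ y
    obtain ⟨⟨m, s⟩, hm⟩ := IsLocalizedModule.surj S f l
    exact ⟨⟨Submodule.Quotient.mk m, s⟩, congrArg (Submodule.Quotient.mk (p := x • (⊤ : Submodule R L))) hm⟩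
  exists_of_eq {a b} hab := by
    obtain ⟨a, rfl⟩ := Submodule.Quotient.mk_surjective _ a
    obtain ⟨b, rfl⟩ := Submodule.Quotient.mk_surjective _ b
    change (Submodule.Quotient.mk (f a) : QuotSMulTop x L) = Submodule.Quotient.mk (f b) at hab
    rw [Submodule.Quotient.eq, Submodule.mem_smul_pointwise_iff_exists] at hab
    obtain ⟨l, -, hl⟩ := hab
    obtain ⟨⟨m, s⟩, hm⟩ := IsLocalizedModule.surj S f l
    refine ⟨s, ?_⟩
    change (Submodule.Quotient.mk ((s : R) • a) : QuotSMulTop x M) = Submodule.Quotient.mk ((s : R) • b)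
    rw [Submodule.Quotient.eq, Submodule.mem_smul_pointwise_iff_exists]
    refine ⟨m, trivial, hf ?_⟩
    change (s : R) • l = f m at hm
    rw [map_smul, ← hm, smul_comm, hl, map_sub, map_smul, map_smul, smul_sub]

lemma isLoc_kerLift (S : Submonoid R) {M L : Type} [AddCommGroup M] [Module R M] [AddCommGroup L]
    [Module R L] (f : M →ₗ[R] L) [IsLocalizedModule S f] :
    IsLocalizedModule S ((LinearMap.ker f).liftQ f le_rfl) where
  map_units s := IsLocalizedModule.map_units f s
  surj y := by
    obtain ⟨⟨m, s⟩, hm⟩ := IsLocalizedModule.surj S f y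
    exact ⟨⟨Submodule.Quotient.mk m, s⟩, hm⟩
  exists_of_eq {a b} hab := by
    obtain ⟨a, rfl⟩ := Submodule.Quotient.mk_surjective _ a
    obtain ⟨b, rfl⟩ := Submodule.Quotient.mk_surjective _ b
    refine ⟨1, ?_⟩
    rw [one_smul, one_smul, Submodule.Quotient.eq, LinearMap.mem_ker, map_sub, sub_eq_zero]
    exact hab

lemma exists_common_kill (S : Submonoid R) (K : Type) [AddCommGroup K] [Module R K]
    [hK : Module.Finite R K] (h : ∀ k : K, ∃ s : S, s • k = 0) : ∃ s : S, ∀ k : K, s • k = 0 := by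
  classical
  obtain ⟨T, hT⟩ := hK
  choose c hc using h
  refine ⟨∏ k ∈ T, c k, fun k => ?_⟩
  have hk : k ∈ Submodule.span R (T : Set K) := by rw [hT]; trivial
  induction hk using Submodule.span_induction with
  | mem x hx =>
    rw [← Finset.prod_erase_mul T c hx, mul_smul, hc, smul_zero]
  | zero => simp
  | add x y _ _ hx hy => rw [smul_add, hx, hy, add_zero]
  | smul a x _ hx => rw [smul_comm, hx, smul_zero]

lemma regseq [IsNoetherianRing R] {p : Ideal R} [hp : p.IsPrime] (n : ℕ) :
    ∀ (M L : Type) [AddCommGroup M] [Module R M] [Module.Finite R M] [AddCommGroup L] [Module R L]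
    (f : M →ₗ[R] L) [IsLocalizedModule p.primeCompl f]
    (_ : ∀ i < n, LZ p (ModuleCat.of R (R ⧸ p)) (ModuleCat.of R M) i),
    ∃ rs : List R, rs.length = n ∧ (∀ r ∈ rs, r ∈ p) ∧ IsWeaklyRegular L rs := by
  induction n with
  | zero => intros; exact ⟨[], rfl, by simp, .nil R _⟩
  | succ n ih =>
    intro M L _ _ _ _ _ f _ h
    let M' := M ⧸ LinearMap.ker f
    let f' : M' →ₗ[R] L := (LinearMap.ker f).liftQ f le_rfl
    have hf' : Function.Injective f' := by
      rw [← LinearMap.ker_eq_bot]; exact Submodule.ker_liftQ_eq_bot _ _ _ le_rfl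
    have : IsLocalizedModule p.primeCompl f' := isLoc_kerLift _ f
    obtain ⟨s, hs⟩ := exists_common_kill p.primeCompl (LinearMap.ker f) (fun k => by
      obtain ⟨s, hs⟩ := (IsLocalizedModule.eq_zero_iff p.primeCompl f).1 k.2
      exact ⟨s, Subtype.ext hs⟩)
    have hS : (ShortComplex.mk (ModuleCat.ofHom (LinearMap.ker f).subtype)
        (ModuleCat.ofHom (LinearMap.ker f).mkQ)
        (by ext x; exact (Submodule.Quotient.mk_eq_zero _).2 x.2)).ShortExact :=
      { exact := (ShortComplex.ShortExact.moduleCat_exact_iff_function_exact _).2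
          (LinearMap.exact_subtype_mkQ _)
        mono_f := (ModuleCat.mono_iff_injective _).2 (Submodule.injective_subtype _)
        epi_g := (ModuleCat.epi_iff_surjective _).2 (Submodule.mkQ_surjective _) }
    have h' : ∀ i < n + 1, LZ p (ModuleCat.of R (R ⧸ p)) (ModuleCat.of R M') i := fun i hi =>
      LZ.coker hS (h i hi) (LZ.of_right (s := s) s.2 hs)
    have hsub : Subsingleton ((R ⧸ p) →ₗ[R] M') := by
      refine subsingleton_of_forall_eq 0 (fun u => ?_)
      obtain ⟨t, ht, hte⟩ := h' 0 (Nat.succ_pos n) (Abelian.Ext.mk₀ (ModuleCat.ofHom u))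
      rw [← Abelian.Ext.mk₀_smul, Abelian.Ext.mk₀_eq_zero_iff] at hte
      ext
      apply hf'
      apply IsLocalizedModule.smul_injective f' (⟨t, ht⟩ : p.primeCompl)
      have := congrArg (fun v => f' (v.hom (1 : R ⧸ p))) hte
      change f' (t • u 1) = f' 0 at this
      change t • f' (u 1) = t • f' 0
      rw [← map_smul, this, map_zero, smul_zero]
    obtain ⟨x, hxp, hx⟩ := IsSMulRegular.subsingleton_linearMap_iff.1 hsub
    rw [Ideal.annihilator_quotient] at hxp
    have := isLoc_quot p.primeCompl f' x hf'
    obtain ⟨ys, hlen, hys, hreg⟩ := ih (QuotSMulTop x M') (QuotSMulTop x L) (QuotSMulTop.map x f')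
      (fun i hi => LZ.coker (S := (ModuleCat.of R M').smulShortComplex x)
        (IsSMulRegular.smulShortComplex_shortExact (M := ModuleCat.of R M') hx) (h' i (by omega)) (h' (i+1) (by omega)))
    refine ⟨x :: ys, by simp [hlen], by simpa using ⟨hxp, hys⟩, .cons ?_ hreg⟩
    intro a b hab
    obtain ⟨⟨m, s⟩, hm⟩ := IsLocalizedModule.surj p.primeCompl f' a
    obtain ⟨⟨m', s'⟩, hm'⟩ := IsLocalizedModule.surj p.primeCompl f' b
    change (s : R) • a = f' m at hm
    change (s' : R) • b = f' m' at hm'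
    change x • a = x • b at hab
    have h1 : (s' : R) • m = (s : R) • m' := by
      apply hx
      apply hf'
      change f' (x • (s' : R) • m) = f' (x • (s : R) • m')
      rw [map_smul, map_smul, map_smul, map_smul, ← hm, ← hm']
      rw [smul_comm x, smul_comm x, smul_comm x, smul_comm x, hab, smul_comm]
    apply IsLocalizedModule.smul_injective f' (s * s')
    change ((s : R) * (s' : R)) • a = ((s : R) * (s' : R)) • b
    rw [mul_smul, mul_smul, smul_comm, hm, hm', ← map_smul, h1, map_smul]
end regseq

section partA
open RingTheory.Sequence

lemma local_step {A : Type} [CommRing A] [IsNoetherianRing A] (m : Ideal A) (xs : List A) :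
    ∀ (M : Type) [AddCommGroup M] [Module A M] [Module.Finite A M] (_ : IsWeaklyRegular M xs)
    (_ : ∀ i < xs.length + 1, Subsingleton (Abelian.Ext (ModuleCat.of A (A ⧸ m)) (ModuleCat.of A M) i)),
    ∃ y ∈ m, IsWeaklyRegular M (xs ++ [y]) := by
  induction xs with
  | nil =>
    intro M _ _ _ _ h
    have h0 := h 0 (by simp)
    have h1 : Subsingleton (ModuleCat.of A (A ⧸ m) ⟶ ModuleCat.of A M) :=
      Abelian.Ext.addEquiv₀.subsingleton_congr.mp h0
    have h2 : Subsingleton ((A ⧸ m) →ₗ[A] M) :=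
      (ModuleCat.homAddEquiv (M := ModuleCat.of A (A ⧸ m)) (N := ModuleCat.of A M)).symm.subsingleton
    obtain ⟨y, hy, hreg⟩ := IsSMulRegular.subsingleton_linearMap_iff.1 h2
    rw [Ideal.annihilator_quotient] at hy
    exact ⟨y, hy, (isWeaklyRegular_singleton_iff M y).2 hreg⟩
  | cons x xs ih =>
    intro M _ _ _ hw h
    rw [isWeaklyRegular_cons_iff] at hw
    obtain ⟨y, hy, hreg⟩ := ih (QuotSMulTop x M) hw.2 (by
      intro i hi
      have zero1 := AddCommGrpCat.isZero_of_iff_subsingleton.mpr (h i (by simp; omega))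
      have zero2 := AddCommGrpCat.isZero_of_iff_subsingleton.mpr (h (i + 1) (by simpa using hi))
      exact AddCommGrpCat.subsingleton_of_isZero <| ShortComplex.Exact.isZero_of_both_zeros
        ((Abelian.Ext.covariant_sequence_exact₃' _ (IsSMulRegular.smulShortComplex_shortExact (M := ModuleCat.of A M) hw.1)) i (i + 1) rfl)
        (zero1.eq_zero_of_src _) (zero2.eq_zero_of_tgt _))
    exact ⟨y, hy, .cons hw.1 hreg⟩

lemma local_step' {A : Type} [CommRing A] [IsNoetherianRing A] [IsLocalRing A] (xs zs : List A)
    (hz : ∀ z ∈ zs, z ∈ IsLocalRing.maximalIdeal A) (hx : IsWeaklyRegular A xs)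
    (hzr : IsWeaklyRegular A zs) (hlt : xs.length < zs.length) :
    ∃ y ∈ IsLocalRing.maximalIdeal A, IsWeaklyRegular A (xs ++ [y]) := by
  refine local_step (IsLocalRing.maximalIdeal A) xs A hx (fun i hi => ?_)
  have hreg : IsRegular A zs :=
    (IsLocalRing.isRegular_iff_isWeaklyRegular_of_subset_maximalIdeal hz).2 hzr
  refine ModuleCat.subsingleton_ext_of_exists_isRegular (IsLocalRing.maximalIdeal A) _ ?_
    (ModuleCat.of A A) ?_ zs hz hreg i (by omega)
  · rw [Module.support_eq_zeroLocus, Ideal.annihilator_quotient]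
  · simpa using (Ideal.IsPrime.ne_top inferInstance).lt_top

variable {R : Type} [CommRing R]

lemma exists_of_lt_seqDepth {I : Ideal R} {M : Type} [AddCommGroup M] [Module R M] {k : ℕ}
    (h : (k : ℕ∞) < seqDepth I M) : ∃ zs : List R, (∀ z ∈ zs, z ∈ I) ∧ IsWeaklyRegular M zs ∧
      k < zs.length := by
  obtain ⟨n, ⟨zs, h1, h2, rfl⟩, hk⟩ := lt_sSup_iff.1 h
  exact ⟨zs, h1, h2, by exact_mod_cast hk⟩

lemma ringDepthAt_mono (hCM : IsCohenMacaulayRing R) {p q : Ideal R} [hp : p.IsPrime] [hq : q.IsPrime]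
    (h : p ≤ q) : ringDepthAt R p ≤ ringDepthAt R q := by
  have h1 := hCM p hp
  have h2 := hCM q hq
  rw [IsLocalization.AtPrime.ringKrullDim_eq_height p (Localization.AtPrime p)] at h1
  rw [IsLocalization.AtPrime.ringKrullDim_eq_height q (Localization.AtPrime q)] at h2
  have h3 := Ideal.height_mono h
  rw [← WithBot.coe_le_coe, h1, h2]
  exact_mod_cast h3

lemma exists_seq [IsNoetherianRing R] (hCM : IsCohenMacaulayRing R)
    (p : Ideal R) [hp : p.IsPrime] (k : ℕ) (hk : (k : ℕ∞) ≤ ringDepthAt R p) :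
    ∃ rs : List R, (∀ r ∈ rs, r ∈ p) ∧ IsWeaklyRegular R rs ∧ rs.length = k := by
  induction k with
  | zero => exact ⟨[], by simp, .nil R R, rfl⟩
  | succ k ih =>
    have hlt : (k : ℕ∞) < ringDepthAt R p := lt_of_lt_of_le (by exact_mod_cast Nat.lt_succ_self k) hk
    obtain ⟨xs, hxp, hxr, hxl⟩ := ih hlt.le
    suffices H : ∃ y ∈ p, IsSMulRegular (R ⧸ (Ideal.ofList xs • ⊤ : Submodule R R)) y by
      obtain ⟨y, hy, hyr⟩ := H
      refine ⟨xs ++ [y], ?_, ?_, by simp [hxl]⟩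
      · intro r hr
        rcases List.mem_append.1 hr with h | h
        · exact hxp r h
        · rw [List.mem_singleton] at h; rwa [h]
      · rw [isWeaklyRegular_append_iff, isWeaklyRegular_singleton_iff]
        exact ⟨hxr, hyr⟩
    by_contra hno
    have hns : ¬ Subsingleton ((R ⧸ p) →ₗ[R] (R ⧸ (Ideal.ofList xs • ⊤ : Submodule R R))) := by
      rw [IsSMulRegular.subsingleton_linearMap_iff, Ideal.annihilator_quotient]
      exact hno
    rw [not_subsingleton_iff_nontrivial] at hns
    obtain ⟨u, hu⟩ := exists_ne (0 : (R ⧸ p) →ₗ[R] (R ⧸ (Ideal.ofList xs • ⊤ : Submodule R R)))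
    have hz : u 1 ≠ 0 := fun h => hu (by ext; exact h)
    obtain ⟨q, hq, hle⟩ := exists_le_isAssociatedPrime_of_isNoetherianRing R (u 1) hz
    have hpq : p ≤ q := by
      intro r hr
      apply hle
      rw [Submodule.mem_colon_singleton, Submodule.mem_bot, ← map_smul]
      have : r • (1 : R ⧸ p) = 0 := by
        rw [Algebra.smul_def, mul_one]
        exact Ideal.Quotient.eq_zero_iff_mem.2 hr
      rw [this, map_zero]
    rw [isAssociatedPrime_iff] at hq
    obtain ⟨hqp, w, hw⟩ := hq
    obtain ⟨w0, rfl⟩ := Submodule.Quotient.mk_surjective _ w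
    have hI : (Ideal.ofList xs • ⊤ : Submodule R R) = Ideal.ofList xs := by simp
    have hmem : ∀ r : R, r ∈ q ↔ r * w0 ∈ Ideal.ofList xs := by
      intro r
      rw [hw, Submodule.mem_colon_singleton, Submodule.mem_bot, ← Submodule.Quotient.mk_smul,
        Submodule.Quotient.mk_eq_zero, hI, smul_eq_mul]
    obtain ⟨zs, hz1, hz2, hz3⟩ := exists_of_lt_seqDepth (lt_of_lt_of_le hlt (ringDepthAt_mono hCM hpq))
    have hxA : IsWeaklyRegular (Localization.AtPrime q) (xs.map (algebraMap R (Localization.AtPrime q))) :=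
      hxr.of_isLocalization (Localization.AtPrime q) q.primeCompl
    have : IsNoetherianRing (Localization.AtPrime q) :=
      IsLocalization.isNoetherianRing q.primeCompl _ inferInstance
    obtain ⟨y, hy, hyr⟩ := local_step' _ zs hz1 hxA hz2 (by simpa [hxl] using hz3)
    rw [isWeaklyRegular_append_iff, isWeaklyRegular_singleton_iff] at hyr
    have hIA : (Ideal.ofList (xs.map (algebraMap R (Localization.AtPrime q))) • ⊤ :
        Submodule (Localization.AtPrime q) (Localization.AtPrime q)) =
        (Ideal.ofList xs).map (algebraMap R (Localization.AtPrime q)) := by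
      rw [Ideal.map_ofList]; simp
    obtain ⟨⟨a, s⟩, has⟩ := IsLocalization.surj q.primeCompl y
    have haq : a ∈ q := by
      rw [← IsLocalization.AtPrime.to_map_mem_maximal_iff (Localization.AtPrime q) q, ← has]
      exact Ideal.mul_mem_right _ _ hy
    have hsu : IsUnit (algebraMap R (Localization.AtPrime q) s) := IsLocalization.map_units _ s
    have h1 : y * algebraMap R (Localization.AtPrime q) w0 ∈
        (Ideal.ofList xs).map (algebraMap R (Localization.AtPrime q)) := by
      rw [← Ideal.unit_mul_mem_iff_mem _ hsu, ← mul_assoc, mul_comm _ y, has, ← map_mul]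
      exact Ideal.mem_map_of_mem _ ((hmem a).1 haq)
    have h2 : (Submodule.Quotient.mk (algebraMap R (Localization.AtPrime q) w0) :
        (Localization.AtPrime q) ⧸ (Ideal.ofList (xs.map (algebraMap R (Localization.AtPrime q))) • ⊤ :
        Submodule (Localization.AtPrime q) (Localization.AtPrime q))) = 0 := by
      apply hyr.2
      change y • _ = y • _
      rw [smul_zero, ← Submodule.Quotient.mk_smul, Submodule.Quotient.mk_eq_zero, hIA]
      exact h1
    rw [Submodule.Quotient.mk_eq_zero, hIA,
      IsLocalization.algebraMap_mem_map_algebraMap_iff q.primeCompl] at h2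
    obtain ⟨m, hm, hmw⟩ := h2
    exact hm ((hmem m).2 hmw)

lemma ringDepthAt_le_grade [IsNoetherianRing R] (hCM : IsCohenMacaulayRing R)
    (p : Ideal R) [hp : p.IsPrime] : ringDepthAt R p ≤ p.grade := by
  rw [← ENat.forall_natCast_le_iff_le]
  intro k hk
  obtain ⟨rs, h1, h2, h3⟩ := exists_seq hCM p k hk
  exact le_sSup ⟨rs, h1, h2, by rw [h3]⟩
end partA

end S14

theorem stmt14 {R : Type} [CommRing R] [IsNoetherianRing R] (hCM : IsCohenMacaulayRing R)
    (p : Ideal R) [p.IsPrime]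
    (M : Type) [AddCommGroup M] [Module R M] [Module.Finite R M]
    (hnz : Nontrivial (LocalizedModule p.primeCompl M)) (t : ℕ)
    (h : ∃ s ∉ p, ∀ (a : Ideal R) (i : ℕ), (i : ℕ∞) + t < a.grade →
      ∀ x : ((localCohomology a i).obj (ModuleCat.of R M)), s • x = 0) :
    ringDepthAt R p ≤ moduleDepthAt p M + t := by
  obtain ⟨s, hs, h⟩ := h
  by_contra hlt
  rw [not_le] at hlt
  have hlt' := lt_of_lt_of_le hlt (S14.ringDepthAt_le_grade hCM p)
  have hfin : moduleDepthAt p M ≠ ⊤ := by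
    intro htop
    rw [htop, top_add] at hlt
    exact not_top_lt hlt
  obtain ⟨d, hd⟩ := ENat.ne_top_iff_exists.1 hfin
  have hLZ := S14.LZ_all (p := p) (ModuleCat.of R M) (d + 1) s hs (fun i hi =>
    h p i (lt_of_le_of_lt (by
      rw [← hd]
      exact_mod_cast Nat.add_le_add_right (Nat.lt_succ_iff.1 hi) t) hlt'))
  obtain ⟨rs, hlen, hmem, hreg⟩ := S14.regseq (p := p) (d + 1) M (LocalizedModule p.primeCompl M)
    (LocalizedModule.mkLinearMap p.primeCompl M) hLZ
  have hle : ((d + 1 : ℕ) : ℕ∞) ≤ moduleDepthAt p M := by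
    refine le_sSup ⟨rs.map (algebraMap R (Localization.AtPrime p)), ?_, ?_, by simp [hlen]⟩
    · intro r hr
      obtain ⟨r', hr', rfl⟩ := List.mem_map.1 hr
      exact (IsLocalization.AtPrime.to_map_mem_maximal_iff (Localization.AtPrime p) p r').2
        (hmem r' hr')
    · exact (RingTheory.Sequence.isWeaklyRegular_map_algebraMap_iff (S := Localization.AtPrime p)
        (M := LocalizedModule p.primeCompl M) rs).2 hreg
  rw [← hd] at hle
  exact absurd (by exact_mod_cast hle : d + 1 ≤ d) (by omega)
end

section
/- Let R be a commutative Noetherian ring, p a prime ideal such that depth R_q = grade(q,R) for all primes q ⊆ p, and M a finitely generated R-module. If there exists s ∈ R \ p with s·H^i_a(M) = 0 for all ideals a and all i < grade(a,R), then depth M_q ≥ depth R_q for every prime q ⊆ p. -/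
section Helpers

open scoped Pointwise
open CategoryTheory Limits Opposite localCohomology

/-- augmentation of the chosen projective resolution -/
noncomputable def augm {R : Type} [CommRing R] (X : ModuleCat.{0} R) :
    (projectiveResolution X).complex.X 0 ⟶ X := (projectiveResolution X).π.f 0

lemma d_augm {R : Type} [CommRing R] (X : ModuleCat.{0} R) :
    (projectiveResolution X).complex.d 1 0 ≫ augm X = 0 :=
  (projectiveResolution X).complex_d_comp_π_f_zero

instance epi_augm {R : Type} [CommRing R] (X : ModuleCat.{0} R) : Epi (augm X) :=
  inferInstanceAs (Epi ((projectiveResolution X).π.f 0))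

/-- the key elementary condition -/
def KillsCoh {R : Type} [CommRing R] {D : Type} [SmallCategory D] (X : D ⥤ ModuleCat.{0} R)
    (s : R) (i : ℕ) (Y : ModuleCat.{0} R) : Prop :=
  ∀ (t : D) (f : (projectiveResolution (X.obj t)).complex.X i ⟶ Y),
    (projectiveResolution (X.obj t)).complex.d (i+1) i ≫ f = 0 →
    ∃ (t' : D) (w : t' ⟶ t)
      (φ : (projectiveResolution (X.obj t')).complex ⟶ (projectiveResolution (X.obj t)).complex),
      φ.f 0 ≫ augm (X.obj t) =
        augm (X.obj t') ≫ X.map w ∧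
      ∃ (j : ℕ) (g : (projectiveResolution (X.obj t')).complex.X j ⟶ Y),
        s • (φ.f i ≫ f) = (projectiveResolution (X.obj t')).complex.d i j ≫ g

lemma KillsCoh.mono {R : Type} [CommRing R] {D : Type} [SmallCategory D] {X : D ⥤ ModuleCat.{0} R}
    {s : R} {i : ℕ} {Y : ModuleCat.{0} R} (h : KillsCoh X s i Y) (r : R) :
    KillsCoh X (r * s) i Y := by
  intro t f hf
  obtain ⟨t', w, φ, hφ, j, g, hg⟩ := h t f hf
  refine ⟨t', w, φ, hφ, j, r • g, ?_⟩
  rw [mul_smul, hg, Linear.comp_smul]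

lemma KillsCoh.of_smul {R : Type} [CommRing R] {D : Type} [SmallCategory D]
    {X : D ⥤ ModuleCat.{0} R} {s : R} {Y : ModuleCat.{0} R} (h : ∀ y : Y, s • y = 0) (i : ℕ) :
    KillsCoh X s i Y := by
  intro t f hf
  refine ⟨t, 𝟙 t, 𝟙 _, by simp, i, 0, ?_⟩
  ext x
  exact h _

lemma KillsCoh.third {R : Type} [CommRing R] {D : Type} [SmallCategory D]
    {X : D ⥤ ModuleCat.{0} R} {S : ShortComplex (ModuleCat.{0} R)} (hS : S.ShortExact)
    {s s' : R} {i : ℕ} (hA : KillsCoh X s (i+1) S.X₁) (hB : KillsCoh X s' i S.X₂) :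
    KillsCoh X (s' * s) i S.X₃ := by
  intro t f hf
  have := hS.mono_f
  have := hS.epi_g
  have hproj : ∀ t i, Projective ((projectiveResolution (X.obj t)).complex.X i) :=
    fun t i => (projectiveResolution (X.obj t)).projective i
  -- lift to the middle
  let f' := Projective.factorThru f S.g
  have hf' : f' ≫ S.g = f := Projective.factorThru_comp f S.g
  have hz : ((projectiveResolution (X.obj t)).complex.d (i+1) i ≫ f') ≫ S.g = 0 := by
    rw [Category.assoc, hf', hf]
  let u := hS.exact.lift _ hz
  have hu : u ≫ S.f = _ := hS.exact.lift_f _ hz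
  have hu0 : (projectiveResolution (X.obj t)).complex.d (i+1+1) (i+1) ≫ u = 0 := by
    rw [← cancel_mono S.f, Category.assoc, hu]; simp
  obtain ⟨t', w, φ, hφ, j, g, hg⟩ := hA t u hu0
  obtain ⟨g, hg⟩ : ∃ g : (projectiveResolution (X.obj t')).complex.X i ⟶ S.X₁,
      s • (φ.f (i+1) ≫ u) = (projectiveResolution (X.obj t')).complex.d (i+1) i ≫ g := by
    by_cases hj : j = i
    · subst hj; exact ⟨g, hg⟩
    · refine ⟨0, ?_⟩
      rw [hg, HomologicalComplex.shape _ _ _ (by simpa using hj)]; simp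
  have hc : (projectiveResolution (X.obj t')).complex.d (i+1) i ≫
      (s • (φ.f i ≫ f') - g ≫ S.f) = 0 := by
    rw [Preadditive.comp_sub, ← Category.assoc _ g, ← hg, Linear.smul_comp, Category.assoc, hu,
      Linear.comp_smul, ← Category.assoc _ (φ.f i), ← Category.assoc (φ.f (i+1)),
      HomologicalComplex.Hom.comm]
    simp
  obtain ⟨t'', w', φ', hφ', j', g', hg'⟩ := hB t' _ hc
  refine ⟨t'', w' ≫ w, φ' ≫ φ, ?_, j', g' ≫ S.g, ?_⟩
  · rw [HomologicalComplex.comp_f, Category.assoc, hφ, ← Category.assoc, hφ', Category.assoc,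
      X.map_comp]
  · rw [← Category.assoc, ← hg', ← hf']
    simp [mul_smul]

lemma KillsCoh.zero {R : Type} [CommRing R] {D : Type} [SmallCategory D]
    {X : D ⥤ ModuleCat.{0} R} (hX : ∀ (t t' : D) (w : t ⟶ t'), Epi (X.map w))
    {s : R} {Y : ModuleCat.{0} R} (h : KillsCoh X s 0 Y) (t : D) (f : X.obj t ⟶ Y) :
    s • f = 0 := by
  obtain ⟨t', w, φ, hφ, j, g, hg⟩ := h t (augm (X.obj t) ≫ f)
    (by rw [← Category.assoc, d_augm, zero_comp])
  rw [HomologicalComplex.shape _ _ _ (by simp), ← Category.assoc, hφ, zero_comp,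
    ← Linear.comp_smul] at hg
  have := hX _ _ w
  rw [← cancel_epi (augm (X.obj t') ≫ X.map w), hg, comp_zero]

lemma link {R : Type} [CommRing R] {X : ModuleCat.{0} R}
    (P : ProjectiveResolution X) (Y : ModuleCat.{0} R) (i : ℕ)
    (f : P.complex.X i ⟶ Y) (hf : P.complex.d (i+1) i ≫ f = 0) :
    ∃ e : ((Ext R (ModuleCat.{0} R) i).obj (op X)).obj Y,
      ∀ (X' : ModuleCat.{0} R) (w : X' ⟶ X) (P' : ProjectiveResolution X')
      (φ : P'.complex ⟶ P.complex) (_ : φ.f 0 ≫ P.π.f 0 = P'.π.f 0 ≫ w)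
      (s : R), (((Ext R (ModuleCat.{0} R) i).map w.op).app Y) (s • e) = 0 →
      ∃ (j : ℕ) (g : P'.complex.X j ⟶ Y), s • (φ.f i ≫ f) = P'.complex.d i j ≫ g := by
  let F := ((linearYoneda R (ModuleCat.{0} R)).obj Y).rightOp
  let K := (F.mapHomologicalComplex (ComplexShape.down ℕ)).obj P.complex
  let k : K.X i ⟶ op (ModuleCat.of R R) :=
    (ModuleCat.ofHom (LinearMap.toSpanSingleton R (P.complex.X i ⟶ Y) f)).op
  have hk : K.d (i+1) i ≫ k = 0 := by
    apply Quiver.Hom.unop_inj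
    apply ModuleCat.hom_ext
    apply LinearMap.ext_ring
    change P.complex.d (i+1) i ≫ ((1:R) • f) = 0
    rw [one_smul, hf]
  let c : K.homology i ⟶ op (ModuleCat.of R R) :=
    K.homologyι i ≫ K.descOpcycles k (i+1) (by simp) hk
  let E : (F.leftDerived i).obj X ≅ K.homology i := P.isoLeftDerivedObj F i
  refine ⟨(E.hom ≫ c).unop (1:R), ?_⟩
  intro X' w P' φ hφ s hs
  let K' := (F.mapHomologicalComplex (ComplexShape.down ℕ)).obj P'.complex
  let Φ : K' ⟶ K := (F.mapHomologicalComplex _).map φ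
  let E' : (F.leftDerived i).obj X' ≅ K'.homology i := P'.isoLeftDerivedObj F i
  have hnat : (F.leftDerived i).map w ≫ E.hom = E'.hom ≫ HomologicalComplex.homologyMap Φ i :=
    P'.isoLeftDerivedObj_hom_naturality w P φ hφ F i
  let m : op (ModuleCat.of R R) ⟶ op (ModuleCat.of R R) :=
    (ModuleCat.ofHom (LinearMap.toSpanSingleton R R s)).op
  have hs2 : ((F.leftDerived i).map w).unop ((E.hom ≫ c).unop (s • (1:R))) = 0 := by
    rw [map_smul]; exact hs
  have h1 : (F.leftDerived i).map w ≫ (E.hom ≫ c) ≫ m = 0 := by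
    apply Quiver.Hom.unop_inj
    apply ModuleCat.hom_ext
    apply LinearMap.ext_ring
    refine Eq.trans ?_ hs2
    change ((F.leftDerived i).map w).unop ((E.hom ≫ c).unop
      ((1:R) • s)) = ((F.leftDerived i).map w).unop ((E.hom ≫ c).unop (s • (1 : R)))
    congr 2
    simp
  have h2 : HomologicalComplex.homologyMap Φ i ≫ c ≫ m = 0 := by
    rw [← cancel_epi E'.hom, comp_zero, ← h1, Category.assoc E.hom,
      ← Category.assoc ((F.leftDerived i).map w), hnat, Category.assoc E'.hom]
  have h3 : K'.homologyι i ≫ HomologicalComplex.opcyclesMap Φ i ≫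
    K.descOpcycles k (i+1) (by simp) hk ≫ m = 0 := by
    rw [← h2]
    simp [c]
  have hinj : Injective (op (ModuleCat.of R R)) := by infer_instance
  let T := ShortComplex.mk (K'.homologyι i) (K'.fromOpcycles i ((ComplexShape.down ℕ).next i))
    (by simp)
  have hT : T.Exact := ShortComplex.exact_of_f_is_kernel _ (K'.homologyIsKernel i _ rfl)
  have h4 : Φ.f i ≫ k ≫ m = K'.d i _ ≫ hT.descToInjective _ h3 := by
    have h4 := hT.comp_descToInjective _ h3
    change K'.fromOpcycles i _ ≫ _ = _ at h4
    rw [← K'.p_fromOpcycles, Category.assoc, h4]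
    simp
  refine ⟨(ComplexShape.down ℕ).next i, (hT.descToInjective _ h3).unop (1 : R), ?_⟩
  have h5 := congr($(congrArg Quiver.Hom.unop h4) (1:R))
  refine Eq.trans ?_ h5
  change s • (φ.f i ≫ f) = φ.f i ≫ (((1:R) • s) • f)
  simp

lemma quotLoc {R : Type} [CommRing R] (S : Submonoid R) (x : R) (M : Type) [AddCommGroup M]
    [Module R M] : Nonempty (LocalizedModule S (QuotSMulTop x M) ≃ₗ[R] 
      QuotSMulTop x (LocalizedModule S M)) := by
  have e1 := (LocalizedModule.equivTensorProduct S (QuotSMulTop x M)).restrictScalars R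
  have e2 := (LocalizedModule.equivTensorProduct S M).restrictScalars R
  exact ⟨e1 ≪≫ₗ QuotSMulTop.tensorQuotSMulTopEquivQuotSMulTop x _ M ≪≫ₗ QuotSMulTop.congr x e2.symm⟩

lemma exists_reg {R : Type} [CommRing R] [IsNoetherianRing R] (q : Ideal R) [q.IsPrime]
    (M : Type) [AddCommGroup M] [Module R M] [Module.Finite R M]
    (h : ∃ s ∉ q, ∀ m : M, (∀ a ∈ q, a • m = 0) → s • m = 0) :
    ∃ x ∈ q, IsSMulRegular (LocalizedModule q.primeCompl M) x := by
  classical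
  obtain ⟨s, hs, h⟩ := h
  let A := Localization.AtPrime q
  let m := IsLocalRing.maximalIdeal A
  have hsub : Subsingleton ((A ⧸ m) →ₗ[A] LocalizedModule q.primeCompl M) := by
    refine subsingleton_of_forall_eq 0 fun f => ?_
    apply Submodule.linearMap_qext
    ext
    obtain ⟨⟨y, t⟩, hy⟩ := IsLocalizedModule.mk'_surjective q.primeCompl
      (LocalizedModule.mkLinearMap q.primeCompl M) (f (Submodule.Quotient.mk 1))
    simp only [Function.uncurry] at hy
    have hf : ∀ a ∈ q, a • f (Submodule.Quotient.mk 1) = 0 := by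
      intro a ha
      rw [← algebraMap_smul A, ← map_smul, ← Submodule.Quotient.mk_smul]
      have : (Submodule.Quotient.mk (algebraMap R A a • 1) : A ⧸ m) = 0 := by
        rw [Submodule.Quotient.mk_eq_zero]
        simpa [m] using (IsLocalization.AtPrime.to_map_mem_maximal_iff A q a).2 ha
      rw [this, map_zero]
    obtain ⟨u, hu⟩ : ∃ u : q.primeCompl, ∀ a ∈ q, (u:R) • a • y = 0 := by
      obtain ⟨G, hG⟩ := (IsNoetherian.noetherian q : q.FG)
      have : ∀ a ∈ G, ∃ u : q.primeCompl, (u:R) • a • y = 0 := by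
        intro a ha
        have := hf a (hG ▸ Submodule.subset_span ha)
        rw [← hy, ← IsLocalizedModule.mk'_smul, IsLocalizedModule.mk'_eq_zero'] at this
        exact this
      choose! u hu using this
      refine ⟨∏ a ∈ G, u a, fun a ha => ?_⟩
      rw [← hG] at ha
      induction ha using Submodule.span_induction with
      | mem a ha =>
        rw [← Finset.prod_erase_mul _ _ ha]
        rw [Submonoid.coe_mul, mul_smul, hu a ha, smul_zero]
      | zero => simp
      | add a b _ _ h1 h2 => rw [add_smul, smul_add, h1, h2, add_zero]
      | smul c a _ h1 => rw [smul_assoc, smul_comm, h1, smul_zero]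
    have h0 := h ((u:R) • y) (fun a ha => by rw [smul_comm, hu a ha])
    have : f (Submodule.Quotient.mk 1) = 0 := by
      rw [← hy, IsLocalizedModule.mk'_eq_zero']
      exact ⟨⟨s, hs⟩ * u, by rw [mul_smul]; exact h0⟩
    simpa using this
  obtain ⟨r, hr, hreg⟩ := IsSMulRegular.subsingleton_linearMap_iff.1 hsub
  rw [Ideal.annihilator_quotient] at hr
  obtain ⟨⟨x, t⟩, hx⟩ := IsLocalization.surj q.primeCompl r
  refine ⟨x, ?_, ?_⟩
  · rw [← IsLocalization.AtPrime.to_map_mem_maximal_iff A q x, ← hx]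
    exact Ideal.mul_mem_right _ _ hr
  · have : IsSMulRegular (LocalizedModule q.primeCompl M) (algebraMap R A x) := by
      rw [← hx]
      refine hreg.mul ?_
      exact (IsLocalization.map_units A t).isSMulRegular _
    intro a b hab
    apply this
    simpa using hab

lemma ker_killed {R : Type} [CommRing R] [IsNoetherianRing R] (q : Ideal R) [q.IsPrime]
    (M : Type) [AddCommGroup M] [Module R M] [Module.Finite R M] (x : R)
    (hx : IsSMulRegular (LocalizedModule q.primeCompl M) x) :
    ∃ t ∉ q, ∀ m : M, x • m = 0 → t • m = 0 := by
  classical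
  obtain ⟨G, hG⟩ := (IsNoetherian.noetherian (LinearMap.ker (LinearMap.lsmul R M x)))
  have : ∀ a ∈ G, ∃ u : q.primeCompl, (u:R) • a = 0 := by
    intro a ha
    have h1 : a ∈ LinearMap.ker (LinearMap.lsmul R M x) := hG ▸ Submodule.subset_span ha
    have h2 : x • LocalizedModule.mkLinearMap q.primeCompl M a = 0 := by
      rw [← map_smul]; rw [LinearMap.mem_ker] at h1; 
      simp at h1; rw [h1, map_zero]
    have h3 := hx (h2.trans (smul_zero x).symm)
    exact (IsLocalizedModule.eq_zero_iff q.primeCompl _).1 h3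
  choose! u hu using this
  refine ⟨(∏ a ∈ G, u a : q.primeCompl), (∏ a ∈ G, u a : q.primeCompl).2, fun a ha => ?_⟩
  replace ha : a ∈ LinearMap.ker (LinearMap.lsmul R M x) := by simpa using ha
  rw [← hG] at ha
  induction ha using Submodule.span_induction with
  | mem a ha =>
    rw [← Finset.prod_erase_mul _ _ ha]
    rw [Submonoid.coe_mul, mul_smul, hu a ha, smul_zero]
  | zero => simp
  | add a b _ _ h1 h2 => rw [smul_add, h1, h2, add_zero]
  | smul c a _ h1 => rw [smul_comm, h1, smul_zero]

lemma link2 {R : Type} [CommRing R] (a : Ideal R) (i : ℕ) (s : R) (Y : ModuleCat.{0} R)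
    (h : ∀ x : ((localCohomology a i).obj Y), s • x = 0) :
    KillsCoh (ringModIdeals (idealPowersDiagram a)) s i Y := by
  intro t f hf
  let X := ringModIdeals (idealPowersDiagram a)
  let G : ℕᵒᵖᵒᵖ ⥤ ModuleCat.{0} R := diagram (idealPowersDiagram a) i ⋙ (evaluation _ _).obj Y
  have hc : IsColimit (((evaluation _ _).obj Y).mapCocone
      (colimit.cocone (diagram (idealPowersDiagram a) i))) :=
    isColimitOfPreserves _ (colimit.isColimit _)
  have key : ∀ (t : ℕᵒᵖ) (e : ((Ext R (ModuleCat.{0} R) i).obj (op (X.obj t))).obj Y),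
      ∃ (t' : ℕᵒᵖ) (w : t' ⟶ t),
        ((Ext R (ModuleCat.{0} R) i).map (X.map w).op).app Y (s • e) = 0 := by
    intro t e
    have h0 := h ((colimit.ι (diagram (idealPowersDiagram a) i) (op t)).app Y e)
    have h0 := ((map_smul (ModuleCat.Hom.hom
      ((colimit.ι (diagram (idealPowersDiagram a) i) (op t)).app Y)) s e)).trans h0
    obtain ⟨k, u, v, huv⟩ := Concrete.isColimit_exists_of_rep_eq G hc
      (i := op t) (j := op t) (s • e) 0 (by
        refine Eq.trans h0 ?_
        exact (map_zero (ModuleCat.Hom.hom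
          ((colimit.ι (diagram (idealPowersDiagram a) i) (op t)).app Y))).symm)
    refine ⟨k.unop, u.unop, huv.trans (map_zero (ModuleCat.Hom.hom (G.map v)))⟩
  obtain ⟨e, he⟩ := link (projectiveResolution (X.obj t)) Y i f hf
  obtain ⟨t', w, hw⟩ := key t e
  have hφ := ProjectiveResolution.lift_commutes_zero (X.map w)
    (projectiveResolution (X.obj t')) (projectiveResolution (X.obj t))
  exact ⟨t', w, ProjectiveResolution.lift (X.map w) _ _, hφ, he _ (X.map w) _ _ hφ s hw⟩

lemma main_ind {R : Type} [CommRing R] [IsNoetherianRing R] (q : Ideal R) [q.IsPrime] (n : ℕ) :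
    ∀ (M : Type) [AddCommGroup M] [Module R M] [Module.Finite R M],
    (∀ i < n, ∃ s ∉ q, KillsCoh (ringModIdeals (idealPowersDiagram q)) s i (ModuleCat.of R M)) →
    ∃ rs : List R, (∀ r ∈ rs, r ∈ q) ∧ rs.length = n ∧
      RingTheory.Sequence.IsWeaklyRegular (LocalizedModule q.primeCompl M) rs := by
  induction n with
  | zero => intro M _ _ _ _; exact ⟨[], by simp, rfl, RingTheory.Sequence.IsWeaklyRegular.nil _ _⟩
  | succ n ih =>
    intro M _ _ _ h
    obtain ⟨x, hxq, hx⟩ := exists_reg q M (by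
      obtain ⟨s, hs, hk⟩ := h 0 (by omega)
      refine ⟨s, hs, fun m hm => ?_⟩
      let f : (R ⧸ q ^ 1) →ₗ[R] M := Submodule.liftQ _ (LinearMap.toSpanSingleton R M m) (by
        intro a ha
        rw [pow_one] at ha
        simpa using hm a ha)
      have := hk.zero (fun t t' w => by
        rw [ModuleCat.epi_iff_surjective]
        intro y
        obtain ⟨y, rfl⟩ := Submodule.Quotient.mk_surjective _ y
        exact ⟨Submodule.Quotient.mk y, rfl⟩) (op 1) (ModuleCat.ofHom f)
      have h2 := congr($this (Submodule.Quotient.mk (1:R)))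
      have h3 : s • ((1:R) • m) = 0 := h2
      simpa using h3)
    obtain ⟨t, htq, ht⟩ := ker_killed q M x hx
    let l := LinearMap.lsmul R M x
    let S1 : ShortComplex (ModuleCat.{0} R) := ShortComplex.mk
      (ModuleCat.ofHom (LinearMap.ker l).subtype) (ModuleCat.ofHom l.rangeRestrict)
      (by ext y; exact y.2)
    have hS1 : S1.ShortExact := by
      refine { exact := ?_, mono_f := ?_, epi_g := ?_ }
      · rw [ShortComplex.moduleCat_exact_iff]
        intro y hy
        exact ⟨⟨y, congrArg Subtype.val hy⟩, rfl⟩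
      · exact (ModuleCat.mono_iff_injective _).2 (Subtype.val_injective)
      · exact (ModuleCat.epi_iff_surjective _).2 l.surjective_rangeRestrict
    have hr : ∀ y, y ∈ LinearMap.range l ↔ y ∈ x • (⊤ : Submodule R M) := by
      intro y
      rw [Submodule.mem_smul_pointwise_iff_exists]
      simp [l]
    let S2 : ShortComplex (ModuleCat.{0} R) := ShortComplex.mk
      (ModuleCat.ofHom (LinearMap.range l).subtype)
      (ModuleCat.ofHom (x • (⊤ : Submodule R M)).mkQ)
      (by ext y; exact (Submodule.Quotient.mk_eq_zero _).2 ((hr _).1 y.2))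
    have hS2 : S2.ShortExact := by
      refine { exact := ?_, mono_f := ?_, epi_g := ?_ }
      · rw [ShortComplex.moduleCat_exact_iff]
        intro y hy
        exact ⟨⟨y, (hr _).2 ((Submodule.Quotient.mk_eq_zero _).1 hy)⟩, rfl⟩
      · exact (ModuleCat.mono_iff_injective _).2 (Subtype.val_injective)
      · exact (ModuleCat.epi_iff_surjective _).2 (Submodule.mkQ_surjective _)
    obtain ⟨rs, hrs, hlen, hreg⟩ := ih (QuotSMulTop x M) (by
      intro i hi
      obtain ⟨s, hs, hk⟩ := h i (by omega)
      obtain ⟨s', hs', hk'⟩ := h (i+1) (by omega)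
      have hA : KillsCoh (ringModIdeals (idealPowersDiagram q)) t (i+1+1) S1.X₁ :=
        KillsCoh.of_smul (fun (y : LinearMap.ker l) => Subtype.ext (ht _ y.2)) _
      have hB := KillsCoh.third hS1 hA hk'
      have hC := KillsCoh.third (S := S2) hS2 hB hk
      refine ⟨_, ?_, hC⟩
      exact Ideal.IsPrime.mul_notMem ‹_› hs (Ideal.IsPrime.mul_notMem ‹_› hs' htq))
    refine ⟨x :: rs, by simpa using ⟨hxq, hrs⟩, by simp [hlen], ?_⟩
    obtain ⟨e⟩ := quotLoc q.primeCompl x M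
    exact RingTheory.Sequence.IsWeaklyRegular.cons hx ((e.isWeaklyRegular_congr rs).1 hreg)

end Helpers

theorem stmt17 {R : Type} [CommRing R] [IsNoetherianRing R]
    (p : Ideal R) [p.IsPrime]
    (hgrade : ∀ (q : Ideal R) (hq : q.IsPrime), q ≤ p → @ringDepthAt R _ q hq = q.grade)
    (M : Type) [AddCommGroup M] [Module R M] [Module.Finite R M]
    (h : ∃ s ∉ p, ∀ (a : Ideal R) (i : ℕ), (i : ℕ∞) < a.grade →
      ∀ x : ((localCohomology a i).obj (ModuleCat.of R M)), s • x = 0) :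
    ∀ (q : Ideal R) (hq : q.IsPrime), q ≤ p →
      @ringDepthAt R _ q hq ≤ @moduleDepthAt R _ q hq M _ _ := by
  obtain ⟨s, hs, h⟩ := h
  intro q hq hqp
  refine ENat.forall_natCast_le_iff_le.1 fun n hn => ?_
  rw [hgrade q hq hqp] at hn
  obtain ⟨rs, hrs, hlen, hreg⟩ := main_ind q n M (fun i hi =>
    ⟨s, fun hsq => hs (hqp hsq), link2 q i s _ (h q i (lt_of_lt_of_le (by exact_mod_cast hi) hn))⟩)
  refine le_sSup ⟨rs.map (algebraMap R (Localization.AtPrime q)), ?_, ?_, by simp [hlen]⟩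
  · intro r hr
    obtain ⟨a, ha, rfl⟩ := List.mem_map.1 hr
    exact (IsLocalization.AtPrime.to_map_mem_maximal_iff _ q a).2 (hrs a ha)
  · exact (RingTheory.Sequence.isWeaklyRegular_map_algebraMap_iff _ _ rs).2 hreg
end
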